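/- arXiv:1503.04428 — 2 statements merged into one kernel-verified Lean document; each statement's English description precedes it below -/
import Mathlib

section
/- Let D ≥ 2 be an integer and let χ be a primitive quadratic Dirichlet character modulo D, i.e. χ is a nonprincipal Dirichlet character modulo D of conductor D taking only the values −1, 0, 1. Then the (conditionally convergent) series L(1, χ) = Σ_{n=1}^∞ χ(n)/n satisfies L(1, χ) ≤ 1 + (1/2)·ln D. -/
namespace Watson
open ZMod Filter Topology

lemma complexify_primitive {D : ℕ} [NeZero D] (χ : DirichletCharacter ℝ D) (h : χ.IsPrimitive) :
    DirichletCharacter.IsPrimitive (χ.ringHomComp Complex.ofRealHom : DirichletCharacter ℂ D) := by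
  rw [DirichletCharacter.isPrimitive_def] at h ⊢
  apply Nat.le_antisymm
  · exact Nat.le_of_dvd (Nat.pos_of_ne_zero (NeZero.ne D)) (DirichletCharacter.conductor_dvd_level _)
  · conv_lhs => rw [← h]
    refine Nat.sInf_le ?_
    rw [DirichletCharacter.mem_conductorSet_iff]
    have h1 := DirichletCharacter.factorsThrough_conductor
      (χ.ringHomComp Complex.ofRealHom : DirichletCharacter ℂ D)
    have hd := h1.dvd
    rw [DirichletCharacter.factorsThrough_iff_ker_unitsMap hd] at h1 ⊢
    intro x hx
    have h2 := h1 hx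
    rw [MonoidHom.mem_ker, Units.ext_iff, MulChar.coe_toUnitHom] at h2 ⊢
    rw [MulChar.ringHomComp_apply] at h2
    simp only [Complex.ofRealHom_eq_coe, Units.val_one] at h2 ⊢
    exact_mod_cast h2

lemma exists_gauss {D : ℕ} [NeZero D] (χ : DirichletCharacter ℝ D) (h : χ.IsPrimitive)
    (hq : ∀ a : ZMod D, χ a = 0 ∨ χ a = 1 ∨ χ a = -1) :
    ∃ c : ℂ, c ^ 2 = D * (χ (-1) : ℝ) ∧
      ∀ n : ℕ, c * (χ (n : ZMod D) : ℝ) = ∑ j : ZMod D, (χ j : ℂ) * (stdAddChar j : ℂ) ^ n := by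
  set ψ : DirichletCharacter ℂ D := χ.ringHomComp Complex.ofRealHom with hψ
  have hψa : ∀ a, ψ a = ((χ a : ℝ) : ℂ) := fun a => by rw [hψ, MulChar.ringHomComp_apply]; rfl
  have hprim : ψ.IsPrimitive := complexify_primitive χ h
  have hquad : ψ.IsQuadratic := by
    intro a
    rw [hψa]
    rcases hq a with h | h | h <;> simp [h]
  have hF : ∀ k, 𝓕 (⇑ψ) k = ψ (-k) * gaussSum ψ stdAddChar := by
    intro k
    rw [hprim.fourierTransform_eq_inv_mul_gaussSum, hquad.inv]
  refine ⟨gaussSum ψ stdAddChar, ?_, ?_⟩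
  · have h2 := congrFun (dft_dft (⇑ψ)) 1
    have h3 : 𝓕 (⇑ψ) = (gaussSum ψ stdAddChar * ψ (-1)) • (⇑ψ) := by
      funext k
      rw [hF, ← neg_one_mul k, map_mul]
      simp only [Pi.smul_apply, smul_eq_mul]; ring
    rw [h3, _root_.map_smul, h3] at h2
    simp only [Pi.smul_apply, smul_eq_mul, map_one, mul_one] at h2
    have h4 : ψ (-1) * ψ (-1) = 1 := by rw [← map_mul]; simp
    rw [← hψa]
    linear_combination h2 - gaussSum ψ stdAddChar ^ 2 * h4
  · intro n
    have h1 := hF (-(n : ZMod D))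
    rw [neg_neg, dft_apply] at h1
    rw [mul_comm, ← hψa, ← h1]
    refine Finset.sum_congr rfl fun j _ => ?_
    rw [hψa, smul_eq_mul, mul_comm, mul_neg, neg_neg, mul_comm j, ← nsmul_eq_mul,
      AddChar.map_nsmul_eq_pow]

lemma std_norm {D : ℕ} [NeZero D] (j : ZMod D) : ‖(stdAddChar j : ℂ)‖ = 1 := by
  rw [stdAddChar_apply]; exact Circle.norm_coe _

lemma std_ne_one {D : ℕ} [NeZero D] {j : ZMod D} (hj : j ≠ 0) : (stdAddChar j : ℂ) ≠ 1 := by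
  intro h
  apply hj
  apply injective_stdAddChar
  rw [h, AddChar.map_zero_eq_one]

lemma re_pos_one {z : ℂ} (hz : ‖z‖ = 1) (h1 : z ≠ 1) : z.re < 1 := by
  refine lt_of_le_of_ne (hz ▸ Complex.re_le_norm z) fun h => h1 ?_
  have h2 : z.re * z.re + z.im * z.im = 1 := by
    rw [← Complex.normSq_apply, Complex.normSq_eq_norm_sq, hz]; norm_num
  apply Complex.ext
  · simpa using h
  · rw [h] at h2; simp; nlinarith

/-- convergence -/
lemma exists_lim {D : ℕ} [NeZero D] (hD : D ≠ 1) (χ : DirichletCharacter ℝ D)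
    (c : ℂ) (hc : c ≠ 0)
    (hcn : ∀ n : ℕ, c * (χ (n : ZMod D) : ℝ) = ∑ j : ZMod D, (χ j : ℂ) * (stdAddChar j : ℂ) ^ n) :
    ∃ S : ℝ, Tendsto (fun N : ℕ => ∑ n ∈ Finset.range N, χ (n : ZMod D) / (n : ℝ)) atTop (𝓝 S) := by
  have h0 : χ 0 = 0 := χ.map_zero' hD
  have hb : ∀ N, ‖∑ i ∈ Finset.range N, χ ((i:ℕ) : ZMod D)‖ ≤
      (∑ j : ZMod D, |χ j| * (2 / ‖(stdAddChar j : ℂ) - 1‖)) / ‖c‖ := by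
    intro N
    rw [le_div_iff₀ (norm_pos_iff.2 hc)]
    have : ‖∑ i ∈ Finset.range N, χ ((i:ℕ) : ZMod D)‖ * ‖c‖ =
        ‖∑ j : ZMod D, (χ j : ℂ) * ∑ i ∈ Finset.range N, (stdAddChar j : ℂ) ^ i‖ := by
      simp_rw [Finset.mul_sum]
      rw [Finset.sum_comm]
      simp_rw [← hcn]
      rw [← Finset.mul_sum, norm_mul, mul_comm, ← Complex.ofReal_sum, Complex.norm_real]
    rw [this]
    refine (norm_sum_le _ _).trans (Finset.sum_le_sum fun j _ => ?_)
    rw [norm_mul, Complex.norm_real, Real.norm_eq_abs]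
    by_cases hj : j = 0
    · simp [hj, h0]
    refine mul_le_mul_of_nonneg_left ?_ (abs_nonneg _)
    rw [geom_sum_eq (std_ne_one hj), norm_div]
    gcongr
    refine (norm_sub_le _ _).trans ?_
    rw [norm_pow, std_norm]; norm_num
  have hf : Antitone (fun n : ℕ => 1 / ((n : ℝ) + 1)) := by
    intro a b hab
    simp only
    gcongr
  -- shift: use weights 1/(n+1) with z n = χ(n+1)
  have hb' : ∀ N, ‖∑ i ∈ Finset.range N, χ ((i + 1 : ℕ) : ZMod D)‖ ≤
      (∑ j : ZMod D, |χ j| * (2 / ‖(stdAddChar j : ℂ) - 1‖)) / ‖c‖ := by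
    intro N
    have := hb (N + 1)
    rw [Finset.sum_range_succ'] at this
    simpa [h0] using this
  have hC := hf.cauchySeq_series_mul_of_tendsto_zero_of_bounded
    tendsto_one_div_add_atTop_nhds_zero_nat hb'
  obtain ⟨S, hS⟩ := cauchySeq_tendsto_of_complete hC
  refine ⟨S, ?_⟩
  rw [← tendsto_add_atTop_iff_nat 1]
  refine hS.congr fun N => ?_
  rw [Finset.sum_range_succ']
  simp only [Nat.cast_zero, div_zero, add_zero, smul_eq_mul]
  refine Finset.sum_congr rfl fun i _ => ?_
  push_cast; ring

lemma one_sub_slit {z : ℂ} (h : z.re < 1) : 1 - z ∈ Complex.slitPlane := by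
  left; simpa using h

lemma re_smul_lt {z : ℂ} (hz : ‖z‖ = 1) {r : ℝ} (h0 : 0 ≤ r) (h1 : r < 1) : ((r : ℂ) * z).re < 1 := by
  refine (Complex.re_le_norm _).trans_lt ?_
  rw [norm_mul, hz, Complex.norm_real, Real.norm_eq_abs, abs_of_nonneg h0]; simpa using h1

lemma hasSum_L {D : ℕ} [NeZero D] (χ : DirichletCharacter ℝ D) (c : ℂ)
    (hcn : ∀ n : ℕ, c * (χ (n : ZMod D) : ℝ) = ∑ j : ZMod D, (χ j : ℂ) * (stdAddChar j : ℂ) ^ n)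
    {r : ℝ} (h0 : 0 ≤ r) (h1 : r < 1) :
    HasSum (fun n : ℕ => c * ((χ (n : ZMod D) / n * r ^ n : ℝ) : ℂ))
      (∑ j : ZMod D, (χ j : ℂ) * (-Complex.log (1 - r * (stdAddChar j : ℂ)))) := by
  have : ∀ j : ZMod D, HasSum (fun n : ℕ => (χ j : ℂ) * ((r * (stdAddChar j : ℂ)) ^ n / n))
      ((χ j : ℂ) * (-Complex.log (1 - r * (stdAddChar j : ℂ)))) := by
    intro j
    apply HasSum.mul_left
    apply Complex.hasSum_taylorSeries_neg_log
    rw [norm_mul, std_norm, Complex.norm_real, Real.norm_eq_abs, abs_of_nonneg h0]; simpa using h1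
  refine (hasSum_sum fun j _ => this j).congr_fun ?_
  intro n
  have := hcn n
  push_cast
  rw [show c * ((χ (n : ZMod D) : ℂ) / n * r ^ n) = (c * (χ (n : ZMod D) : ℝ)) * (r ^ n / n) by ring, this,
    Finset.sum_mul]
  refine Finset.sum_congr rfl fun j _ => ?_
  rw [mul_pow]; ring

lemma hasSum_M {D : ℕ} [NeZero D] (χ : DirichletCharacter ℝ D) (c : ℂ)
    (hcn : ∀ n : ℕ, c * (χ (n : ZMod D) : ℝ) = ∑ j : ZMod D, (χ j : ℂ) * (stdAddChar j : ℂ) ^ n)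
    {r : ℝ} (h0 : 0 ≤ r) (h1 : r < 1) :
    HasSum (fun n : ℕ => c * ((χ (n : ZMod D) * r ^ n : ℝ) : ℂ))
      (∑ j : ZMod D, (χ j : ℂ) * (1 - r * (stdAddChar j : ℂ))⁻¹) := by
  have : ∀ j : ZMod D, HasSum (fun n : ℕ => (χ j : ℂ) * ((r * (stdAddChar j : ℂ)) ^ n))
      ((χ j : ℂ) * (1 - r * (stdAddChar j : ℂ))⁻¹) := by
    intro j
    apply HasSum.mul_left
    apply hasSum_geometric_of_norm_lt_one
    rw [norm_mul, std_norm, Complex.norm_real, Real.norm_eq_abs, abs_of_nonneg h0]; simpa using h1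
  refine (hasSum_sum fun j _ => this j).congr_fun ?_
  intro n
  have := hcn n
  push_cast
  rw [show c * ((χ (n : ZMod D) : ℂ) * r ^ n) = (c * (χ (n : ZMod D) : ℝ)) * (r ^ n) by ring, this,
    Finset.sum_mul]
  refine Finset.sum_congr rfl fun j _ => ?_
  rw [mul_pow]; ring

lemma L_eq {D : ℕ} [NeZero D] (hD : D ≠ 1) (χ : DirichletCharacter ℝ D) (c : ℂ)
    (hcn : ∀ n : ℕ, c * (χ (n : ZMod D) : ℝ) = ∑ j : ZMod D, (χ j : ℂ) * (stdAddChar j : ℂ) ^ n)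
    {S : ℝ} (hS : Tendsto (fun N : ℕ => ∑ n ∈ Finset.range N, χ (n : ZMod D) / (n : ℝ)) atTop (𝓝 S)) :
    c * S = ∑ j : ZMod D, (χ j : ℂ) * (-Complex.log (1 - (stdAddChar j : ℂ))) := by
  have h0 : χ 0 = 0 := χ.map_zero' hD
  have hA := Real.tendsto_tsum_powerSeries_nhdsWithin_lt hS
  have hA' : Tendsto (fun x : ℝ => c * ((∑' n : ℕ, χ (n : ZMod D) / (n : ℝ) * x ^ n : ℝ) : ℂ))
      (𝓝[<] 1) (𝓝 (c * S)) :=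
    ((Complex.continuous_ofReal.tendsto _).comp hA).const_mul c
  refine tendsto_nhds_unique hA' ?_
  have hev : (fun r : ℝ => ∑ j : ZMod D, (χ j : ℂ) * (-Complex.log (1 - r * (stdAddChar j : ℂ))))
      =ᶠ[𝓝[<] 1] (fun x : ℝ => c * ((∑' n : ℕ, χ (n : ZMod D) / (n : ℝ) * x ^ n : ℝ) : ℂ)) := by
    have : Set.Ioo (0:ℝ) 1 ∈ 𝓝[<] (1:ℝ) := Ioo_mem_nhdsLT (by norm_num)
    filter_upwards [this] with r hr
    rw [← (hasSum_L χ c hcn hr.1.le hr.2).tsum_eq, tsum_mul_left, Complex.ofReal_tsum]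
  refine Tendsto.congr' hev ?_
  apply tendsto_finsetSum
  intro j _
  by_cases hj : j = 0
  · simp [hj, h0]
  apply Tendsto.const_mul
  apply Tendsto.neg
  have hcont : ContinuousAt (fun r : ℝ => Complex.log (1 - r * (stdAddChar j : ℂ))) 1 := by
    apply ContinuousAt.clog
    · fun_prop
    · simpa using one_sub_slit (re_pos_one (std_norm j) (std_ne_one hj))
  have := hcont.tendsto
  simp only [Complex.ofReal_one, one_mul] at this
  exact this.mono_left nhdsWithin_le_nhds

lemma prod_all {D : ℕ} [NeZero D] (r : ℂ) :
    ∏ j : ZMod D, (1 - r * (stdAddChar j : ℂ)) = 1 - r ^ D := by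
  classical
  have hD : 0 < D := Nat.pos_of_ne_zero (NeZero.ne D)
  have hp := Complex.isPrimitiveRoot_exp D hD.ne'
  have himg : Finset.univ.image (fun j : ZMod D => (stdAddChar j : ℂ)) =
      Polynomial.nthRootsFinset D (1 : ℂ) := by
    apply Finset.eq_of_subset_of_card_le
    · intro x hx
      obtain ⟨j, -, rfl⟩ := Finset.mem_image.1 hx
      rw [Polynomial.mem_nthRootsFinset hD, ← AddChar.map_nsmul_eq_pow]
      simp
    · rw [hp.card_nthRootsFinset, Finset.card_image_of_injective _ injective_stdAddChar,
        Finset.card_univ, ZMod.card]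
  have h := hp.pow_sub_pow_eq_prod_sub_mul (1 : ℂ) r hD
  rw [one_pow, ← himg, Finset.prod_image injective_stdAddChar.injOn] at h
  rw [h]
  exact Finset.prod_congr rfl fun j _ => by ring

lemma prod_ne {D : ℕ} [NeZero D] (r : ℂ) :
    ∏ j ∈ Finset.univ.erase (0 : ZMod D), (1 - r * (stdAddChar j : ℂ)) =
      ∑ i ∈ Finset.range D, r ^ i := by
  have hcl : Continuous (fun r : ℂ =>
      ∏ j ∈ Finset.univ.erase (0 : ZMod D), (1 - r * (stdAddChar j : ℂ))) := by fun_prop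
  have hcr : Continuous (fun r : ℂ => ∑ i ∈ Finset.range D, r ^ i) := by fun_prop
  refine congrFun (Continuous.ext_on (dense_compl_singleton (1 : ℂ)) hcl hcr ?_) r
  intro x hx
  have hx1 : (1 : ℂ) - x ≠ 0 := sub_ne_zero.2 (Ne.symm hx)
  apply mul_left_cancel₀ hx1
  simp only
  rw [mul_neg_geom_sum, ← prod_all, ← Finset.mul_prod_erase Finset.univ _ (Finset.mem_univ (0 : ZMod D))]
  simp

lemma one_sub_ne {z : ℂ} (h : z.re < 1) : 1 - z ≠ 0 := Complex.slitPlane_ne_zero (one_sub_slit h)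

lemma sum_log_le {D : ℕ} [NeZero D] {r : ℝ} (h0 : 0 < r) (h1 : r < 1) :
    ∑ j ∈ Finset.univ.erase (0 : ZMod D), (Real.log ‖1 - (r : ℂ) * (stdAddChar j : ℂ)‖ -
      Real.log ‖1 - (stdAddChar j : ℂ)‖) ≤ 0 := by
  have hz : ∀ j ∈ Finset.univ.erase (0 : ZMod D), ‖1 - (r : ℂ) * (stdAddChar j : ℂ)‖ ≠ 0 := by
    intro j _
    exact norm_ne_zero_iff.2 (one_sub_ne (re_smul_lt (std_norm j) h0.le h1))
  have hz' : ∀ j ∈ Finset.univ.erase (0 : ZMod D), ‖1 - (stdAddChar j : ℂ)‖ ≠ 0 := by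
    intro j hj
    exact norm_ne_zero_iff.2 (one_sub_ne (re_pos_one (std_norm j) (std_ne_one (Finset.ne_of_mem_erase hj))))
  rw [Finset.sum_sub_distrib, ← Real.log_prod hz, ← Real.log_prod hz', sub_nonpos]
  apply Real.log_le_log
  · exact Finset.prod_pos fun j hj => lt_of_le_of_ne (norm_nonneg _) (hz j hj).symm
  · have e1 := prod_ne (D := D) (1 : ℂ)
    have e2 := prod_ne (D := D) (r : ℂ)
    simp only [one_mul, one_pow, Finset.sum_const, Finset.card_range, nsmul_eq_mul, mul_one] at e1
    rw [← norm_prod, ← norm_prod, e1, e2]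
    refine (norm_sum_le _ _).trans ?_
    rw [Complex.norm_natCast]
    calc ∑ i ∈ Finset.range D, ‖(r : ℂ) ^ i‖ ≤ ∑ i ∈ Finset.range D, (1 : ℝ) := by
          refine Finset.sum_le_sum fun i _ => ?_
          rw [norm_pow, Complex.norm_real, Real.norm_eq_abs, abs_of_pos h0]
          exact pow_le_one₀ h0.le h1.le
      _ = D := by simp

lemma log_term_nonneg {z : ℂ} (hz : ‖z‖ = 1) (hz1 : z ≠ 1) {r : ℝ} (h0 : 0 < r) (h1 : r < 1) :
    0 ≤ Real.log ‖1 - (r : ℂ) * z‖ - Real.log ‖1 - z‖ - Real.log r / 2 := by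
  have hp : 0 < ‖1 - z‖ := norm_pos_iff.2 (one_sub_ne (re_pos_one hz hz1))
  have hp' : 0 < ‖1 - (r : ℂ) * z‖ := norm_pos_iff.2 (one_sub_ne (re_smul_lt hz h0.le h1))
  have hsq : r * ‖1 - z‖ ^ 2 ≤ ‖1 - (r : ℂ) * z‖ ^ 2 := by
    have h2 : z.re * z.re + z.im * z.im = 1 := by
      rw [← Complex.normSq_apply, Complex.normSq_eq_norm_sq, hz]; norm_num
    rw [← Complex.normSq_eq_norm_sq, ← Complex.normSq_eq_norm_sq, Complex.normSq_apply,
      Complex.normSq_apply]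
    simp
    nlinarith [sq_nonneg (1 - r)]
  have := Real.log_le_log (by positivity) hsq
  rw [Real.log_mul h0.ne' (by positivity), Real.log_pow, Real.log_pow] at this
  push_cast at this
  linarith

lemma chi_abs_le {D : ℕ} (χ : DirichletCharacter ℝ D)
    (hq : ∀ a : ZMod D, χ a = 0 ∨ χ a = 1 ∨ χ a = -1) (a : ZMod D) : |χ a| ≤ 1 := by
  rcases hq a with h | h | h <;> simp [h]

lemma hasSum_log {r : ℝ} (h0 : 0 < r) (h1 : r < 1) :
    HasSum (fun n : ℕ => r ^ n / n) (-Real.log (1 - r)) := by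
  have h := Real.hasSum_pow_div_log_of_abs_lt_one (x := r) (by rw [abs_of_pos h0]; exact h1)
  rw [← hasSum_nat_add_iff' 1]
  simpa using h

lemma even_bound {D : ℕ} [NeZero D] (hD : 2 ≤ D) (χ : DirichletCharacter ℝ D) (hnp : χ ≠ 1)
    (hq : ∀ a : ZMod D, χ a = 0 ∨ χ a = 1 ∨ χ a = -1) (c : ℂ) (hc : c ^ 2 = D)
    (hcn : ∀ n : ℕ, c * (χ (n : ZMod D) : ℝ) = ∑ j : ZMod D, (χ j : ℂ) * (stdAddChar j : ℂ) ^ n)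
    {S : ℝ} (hS : Tendsto (fun N : ℕ => ∑ n ∈ Finset.range N, χ (n : ZMod D) / (n : ℝ)) atTop (𝓝 S)) :
    S ≤ 1 + Real.log D / 2 := by
  have hχ0 : χ 0 = 0 := χ.map_zero' (by omega)
  have hDpos : (0 : ℝ) < D := by exact_mod_cast (by omega : 0 < D)
  have hD2 : (2 : ℝ) ≤ D := by exact_mod_cast hD
  set s : ℝ := Real.sqrt D with hs
  have hs0 : 0 < s := Real.sqrt_pos.2 hDpos
  have hss : s ^ 2 = D := Real.sq_sqrt hDpos.le
  -- c is real
  have hre : c.re ^ 2 = D := by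
    have h1 := congrArg Complex.re hc
    have h2 := congrArg Complex.im hc
    simp [pow_two] at h1 h2
    have h3 : c.re * c.im = 0 := by linarith
    rcases mul_eq_zero.1 h3 with h | h
    · rw [h] at h1; nlinarith
    · rw [h] at h1; nlinarith
  have habs : |c.re| = s := by rw [hs, ← hre, Real.sqrt_sq_eq_abs]
  set r : ℝ := Real.exp (-(2 / s)) with hr
  have hr0 : 0 < r := Real.exp_pos _
  have hr1 : r < 1 := by rw [hr, Real.exp_lt_one_iff]; simp; positivity
  have hlogr : Real.log r = -(2 / s) := Real.log_exp _
  -- main term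
  have hT := hasSum_L χ c hcn hr0.le hr1
  have hmaj : HasSum (fun n : ℕ => r ^ n / n) (-Real.log (1 - r)) :=
    hasSum_log hr0 hr1
  have hle : ∀ n : ℕ, |χ (n : ZMod D) / n * r ^ n| ≤ r ^ n / n := by
    intro n
    rw [abs_mul, abs_div, abs_of_nonneg (pow_nonneg hr0.le n), Nat.abs_cast, div_mul_eq_mul_div]
    gcongr
    exact mul_le_of_le_one_left (by positivity) (chi_abs_le χ hq _)
  have hsumm : Summable (fun n : ℕ => χ (n : ZMod D) / n * r ^ n) :=
    Summable.of_abs (Summable.of_nonneg_of_le (fun _ => abs_nonneg _) hle hmaj.summable)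
  set T : ℝ := ∑' n : ℕ, χ (n : ZMod D) / n * r ^ n with hTdef
  have hTle : T ≤ -Real.log (1 - r) :=
    hasSum_le (fun n => (le_abs_self _).trans (hle n)) hsumm.hasSum hmaj
  have hcT : c * T = ∑ j : ZMod D, (χ j : ℂ) * (-Complex.log (1 - r * (stdAddChar j : ℂ))) := by
    rw [← hT.tsum_eq, tsum_mul_left, hTdef, Complex.ofReal_tsum]
  have hcS := L_eq (by omega) χ c hcn hS
  have hdiff : c.re * (S - T) = ∑ j : ZMod D, χ j * (Real.log ‖1 - (r : ℂ) * (stdAddChar j : ℂ)‖ -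
      Real.log ‖1 - (stdAddChar j : ℂ)‖) := by
    have h1 := congrArg Complex.re hcS
    have h2 := congrArg Complex.re hcT
    simp only [Complex.re_sum, Complex.re_mul_ofReal, Complex.re_ofReal_mul, Complex.neg_re,
      Complex.log_re] at h1 h2
    rw [mul_sub, h1, h2, ← Finset.sum_sub_distrib]
    exact Finset.sum_congr rfl fun j _ => by ring
  have hsum0 : ∑ j : ZMod D, χ j = 0 := MulChar.sum_eq_zero_of_ne_one hnp
  have hdiff2 : c.re * (S - T) = ∑ j ∈ Finset.univ.erase (0 : ZMod D),
      χ j * (Real.log ‖1 - (r : ℂ) * (stdAddChar j : ℂ)‖ -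
      Real.log ‖1 - (stdAddChar j : ℂ)‖ - Real.log r / 2) := by
    rw [Finset.sum_erase _ (by simp [hχ0]), hdiff]
    simp_rw [mul_sub _ _ (Real.log r / 2)]
    rw [Finset.sum_sub_distrib, ← Finset.sum_mul, hsum0]; simp
  have hbd : s * (S - T) ≤ (D - 1) * (1 / s) := by
    calc s * (S - T) ≤ |c.re * (S - T)| := by
          rw [abs_mul, habs]; exact mul_le_mul_of_nonneg_left (le_abs_self _) hs0.le
      _ ≤ ∑ j ∈ Finset.univ.erase (0 : ZMod D), (Real.log ‖1 - (r : ℂ) * (stdAddChar j : ℂ)‖ -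
          Real.log ‖1 - (stdAddChar j : ℂ)‖ - Real.log r / 2) := by
          rw [hdiff2]
          refine (Finset.abs_sum_le_sum_abs _ _).trans (Finset.sum_le_sum fun j hj => ?_)
          have := log_term_nonneg (std_norm j) (std_ne_one (Finset.ne_of_mem_erase hj)) hr0 hr1
          rw [abs_mul, abs_of_nonneg this]
          exact mul_le_of_le_one_left this (chi_abs_le χ hq _)
      _ ≤ (D - 1) * (1 / s) := by
          rw [Finset.sum_sub_distrib]
          have := sum_log_le (D := D) hr0 hr1
          rw [Finset.sum_const, Finset.card_erase_of_mem (Finset.mem_univ _), Finset.card_univ,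
            ZMod.card, nsmul_eq_mul, hlogr, Nat.cast_sub (by omega)]
          push_cast
          have e : ((D : ℝ) - 1) * (-(2 / s) / 2) = - ((D - 1) * (1 / s)) := by ring
          rw [e]; linarith
  have hST : S - T ≤ 1 := by
    have h3 : (D - 1) * (1 / s) ≤ s := by
      rw [mul_one_div, div_le_iff₀ hs0]; nlinarith
    have : s * (S - T) ≤ s * 1 := by linarith
    exact le_of_mul_le_mul_left this hs0
  -- main term estimate
  have hr2 : 1 / s ≤ 1 - r := by
    set t : ℝ := 1 / s with ht
    have ht0 : 0 < t := by positivity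
    have ht2 : t ^ 2 ≤ 1 / 2 := by
      rw [ht, div_pow, hss, one_pow]
      exact one_div_le_one_div_of_le (by norm_num) hD2
    have hexp : 1 + 2 * t + (2 * t) ^ 2 / 2 ≤ Real.exp (2 * t) :=
      Real.quadratic_le_exp_of_nonneg (by positivity)
    have hrt : r * Real.exp (2 * t) = 1 := by
      rw [hr, ← Real.exp_add, ht]; simp; ring
    have h5 : r * (1 + 2 * t + (2 * t) ^ 2 / 2) ≤ 1 :=
      (mul_le_mul_of_nonneg_left hexp hr0.le).trans_eq hrt
    have h6 : 1 ≤ (1 - t) * (1 + 2 * t + (2 * t) ^ 2 / 2) := by nlinarith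
    have h7 : r * (1 + 2 * t + (2 * t) ^ 2 / 2) ≤ (1 - t) * (1 + 2 * t + (2 * t) ^ 2 / 2) := h5.trans h6
    have := le_of_mul_le_mul_right h7 (by positivity)
    linarith
  have hlog : -Real.log (1 - r) ≤ Real.log D / 2 := by
    have := Real.log_le_log (by positivity) hr2
    rw [one_div, Real.log_inv] at this
    have h8 : Real.log s = Real.log D / 2 := by rw [hs, Real.log_sqrt hDpos.le]
    linarith
  linarith

/-- the kernel for odd characters -/
noncomputable def ff (u : ℝ) : ℝ := Real.arctan u - u / (1 + u ^ 2)

lemma ff_hasDeriv (u : ℝ) : HasDerivAt ff (2 * u ^ 2 / (1 + u ^ 2) ^ 2) u := by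
  have hne : 1 + u ^ 2 ≠ 0 := by positivity
  have h2 : HasDerivAt (fun u : ℝ => 1 + u ^ 2) (2 * u) u := by
    simpa using (hasDerivAt_pow 2 u).const_add 1
  have := (Real.hasDerivAt_arctan u).sub ((hasDerivAt_id u).div h2 hne)
  refine this.congr_deriv ?_
  simp only [id]
  field_simp
  ring

lemma ff_mono : Monotone ff := by
  apply monotone_of_deriv_nonneg (fun u => (ff_hasDeriv u).differentiableAt)
  intro u
  rw [(ff_hasDeriv u).deriv]; positivity

lemma ff_zero : ff 0 = 0 := by simp [ff]

lemma ff_nonneg {u : ℝ} (h : 0 ≤ u) : 0 ≤ ff u := ff_zero ▸ ff_mono h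

lemma ff_neg (u : ℝ) : ff (-u) = - ff u := by
  simp only [ff, Real.arctan_neg, neg_sq]; ring

lemma ff_abs (u : ℝ) : |ff u| = ff |u| := by
  rcases le_total 0 u with h | h
  · rw [abs_of_nonneg h, abs_of_nonneg (ff_nonneg h)]
  · have h2 : 0 ≤ ff (-u) := ff_nonneg (by linarith)
    rw [abs_of_nonpos h, ← abs_neg, ← ff_neg, abs_of_nonneg h2]

lemma arctan_sub_le {u v : ℝ} (hu : 0 ≤ u) (huv : u ≤ v) :
    Real.arctan v - Real.arctan u ≤ 1 / (1 + u ^ 2) * (v - u) := by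
  apply Convex.image_sub_le_mul_sub_of_deriv_le (convex_Ici u) Real.continuous_arctan.continuousOn
    Real.differentiable_arctan.differentiableOn
  · intro x hx
    rw [interior_Ici] at hx
    have hx' : u < x := hx
    rw [(Real.hasDerivAt_arctan x).deriv]
    gcongr
  · exact Set.self_mem_Ici
  · exact huv
  · exact huv

lemma arctan_le {v : ℝ} (hv : 0 ≤ v) : Real.arctan v ≤ v := by
  have := arctan_sub_le le_rfl hv
  simpa using this

lemma abs_arctan_le (v : ℝ) : |Real.arctan v| ≤ |v| := by
  rcases le_total 0 v with h | h
  · rw [abs_of_nonneg h, abs_of_nonneg (Real.arctan_nonneg.2 h)]; exact arctan_le h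
  · have := arctan_le (v := -v) (by linarith)
    rw [abs_of_nonpos h, abs_of_nonpos (Real.arctan_le_zero.2 h), ← Real.arctan_neg]; exact this

lemma sum_ff_le {c : ℝ} (hc : 0 ≤ c) (N : ℕ) :
    ∑ a ∈ Finset.range N, ff (c / ((a : ℝ) + 1)) ≤ N * Real.arctan (c / N) := by
  induction N with
  | zero => simp
  | succ N ih =>
    rw [Finset.sum_range_succ]
    push_cast
    rcases Nat.eq_zero_or_pos N with rfl | hN
    · simp [ff]; positivity
    have hN' : (0 : ℝ) < N := by exact_mod_cast hN
    have h := arctan_sub_le (u := c / ((N : ℝ) + 1)) (v := c / N) (by positivity) (by gcongr; linarith)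
    have e : (N : ℝ) * (1 / (1 + (c / ((N : ℝ) + 1)) ^ 2) * (c / N - c / ((N : ℝ) + 1))) =
        c / ((N : ℝ) + 1) / (1 + (c / ((N : ℝ) + 1)) ^ 2) := by
      have : 1 + (c / ((N : ℝ) + 1)) ^ 2 ≠ 0 := by positivity
      field_simp
      ring
    have h2 := mul_le_mul_of_nonneg_left h hN'.le
    rw [e] at h2
    unfold ff at *
    linarith

lemma sum_ff_le' {c : ℝ} (hc : 0 ≤ c) (N : ℕ) :
    ∑ a ∈ Finset.range N, ff (c / ((a : ℝ) + 1)) ≤ c := by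
  refine (sum_ff_le hc N).trans ?_
  rcases Nat.eq_zero_or_pos N with rfl | hN
  · simpa using hc
  have hN' : (0 : ℝ) < N := by exact_mod_cast hN
  calc (N : ℝ) * Real.arctan (c / N) ≤ N * (c / N) := by
        gcongr; exact arctan_le (by positivity)
    _ = c := by field_simp

lemma arg_one_sub {w : ℂ} (h : w.re < 1) : (1 - w).arg = Real.arctan (-w.im / (1 - w.re)) := by
  symm
  apply Real.arctan_eq_of_tan_eq
  · rw [Complex.tan_arg]; simp
  · have : |(1 - w).arg| < Real.pi / 2 := by
      rw [Complex.abs_arg_lt_pi_div_two_iff]; left; simpa using h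
    exact abs_lt.1 this

lemma odd_term {z : ℂ} (hz : ‖z‖ = 1) (hz1 : z ≠ 1) {κ : ℝ} (h0 : 0 < κ) (h1 : κ < 1) {r l : ℝ}
    (hr : r = (1 - κ) / (1 + κ)) (hl : l = 2 * κ / (1 - κ ^ 2)) :
    (1 - (r : ℂ) * z).arg - (1 - z).arg - l * ((1 - (r : ℂ) * z)⁻¹).im =
      ff (κ * (z.im / (1 - z.re))) := by
  have hr0 : 0 < r := by rw [hr]; apply div_pos <;> linarith
  have hr1 : r < 1 := by rw [hr, div_lt_one (by linarith)]; linarith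
  have hx := re_pos_one hz hz1
  have hrx := re_smul_lt hz hr0.le hr1
  rw [arg_one_sub hx, arg_one_sub hrx, Complex.inv_im, Complex.normSq_apply]
  have h2 : z.re * z.re + z.im * z.im = 1 := by
    rw [← Complex.normSq_apply, Complex.normSq_eq_norm_sq, hz]; norm_num
  simp only [Complex.re_ofReal_mul, Complex.im_ofReal_mul, Complex.sub_re, Complex.sub_im,
    Complex.one_re, Complex.one_im] at hrx ⊢
  generalize z.re = x at *
  generalize z.im = y at *
  have hx' : 0 < 1 - x := by linarith
  have hrx' : 0 < 1 - r * x := by linarith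
  have hκr : κ = (1 - r) / (1 + r) := by
    rw [hr]; field_simp; ring
  have hN : 0 < 1 - 2 * r * x + r ^ 2 := by nlinarith [sq_nonneg (r - x), sq_nonneg y]
  have hy2 : y * y = (1 - x) * (1 + x) := by linarith
  have hprod : κ * (y / (1 - x)) * (r * y / (1 - r * x)) =
      (1 - r) * r * (1 + x) / ((1 + r) * (1 - r * x)) := by
    rw [hκr]
    have : (1 - r) / (1 + r) * (y / (1 - x)) * (r * y / (1 - r * x)) =
       (1 - r) * r * (y * y) / ((1 + r) * (1 - x) * (1 - r * x)) := by
      field_simp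
    rw [this, hy2]
    field_simp
  have hlt : κ * (y / (1 - x)) * (r * y / (1 - r * x)) < 1 := by
    rw [hprod, div_lt_one (by positivity)]
    nlinarith
  have hadd := Real.arctan_add hlt
  have hval : (κ * (y / (1 - x)) + r * y / (1 - r * x)) /
      (1 - κ * (y / (1 - x)) * (r * y / (1 - r * x))) = y / (1 - x) := by
    rw [hprod]
    have e1 : 1 - (1 - r) * r * (1 + x) / ((1 + r) * (1 - r * x)) =
      (1 - 2 * r * x + r ^ 2) / ((1 + r) * (1 - r * x)) := by
      field_simp; ring
    have e2 : κ * (y / (1 - x)) + r * y / (1 - r * x) =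
      y * (1 - 2 * r * x + r ^ 2) / ((1 - x) * ((1 + r) * (1 - r * x))) := by
      rw [hκr]; field_simp; ring
    rw [e1, e2]
    field_simp
  rw [hval] at hadd
  have e3 : -(0 - r * y) / ((1 - r * x) * (1 - r * x) + (0 - r * y) * (0 - r * y)) =
      r * y / (1 - 2 * r * x + r ^ 2) := by
    congr 1
    · ring
    · linear_combination r ^ 2 * h2
  have e5 : 1 + (κ * (y / (1 - x))) ^ 2 = 2 * (1 - 2 * r * x + r ^ 2) / ((1 + r) ^ 2 * (1 - x)) := by
    have : (κ * (y / (1 - x))) ^ 2 = κ ^ 2 * (y * y) / (1 - x) ^ 2 := by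
      field_simp
    rw [this, hy2, hκr]
    field_simp
    ring
  have e4 : l * (r * y / (1 - 2 * r * x + r ^ 2)) =
      κ * (y / (1 - x)) / (1 + (κ * (y / (1 - x))) ^ 2) := by
    have hl2 : l = (1 - r ^ 2) / (2 * r) := by
      have : 1 - ((1 - r) / (1 + r)) ^ 2 = 4 * r / (1 + r) ^ 2 := by field_simp; ring
      rw [hl, hκr, this]; field_simp; ring
    rw [e5, hl2, hκr]
    field_simp
    ring
  rw [e3, e4, ff, neg_div, neg_div, Real.arctan_neg, Real.arctan_neg]
  linarith

lemma cot_bound {θ : ℝ} (h0 : 0 < θ) (h1 : θ < Real.pi) :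
    |Real.cos θ / Real.sin θ| ≤ 1 / θ ∨ |Real.cos θ / Real.sin θ| ≤ 1 / (Real.pi - θ) := by
  have key : ∀ t : ℝ, 0 < t → t ≤ Real.pi / 2 → |Real.cos t / Real.sin t| ≤ 1 / t := by
    intro t ht ht2
    have hs : 0 < Real.sin t := Real.sin_pos_of_pos_of_lt_pi ht (by linarith [Real.pi_pos])
    have hc : 0 ≤ Real.cos t := Real.cos_nonneg_of_neg_pi_div_two_le_of_le (by linarith) ht2
    rw [abs_of_nonneg (by positivity), div_le_div_iff₀ hs ht]
    rcases eq_or_lt_of_le ht2 with h | h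
    · rw [h]; simp
    have hc' : 0 < Real.cos t := Real.cos_pos_of_mem_Ioo ⟨by linarith, h⟩
    have := Real.le_tan ht.le h
    rw [Real.tan_eq_sin_div_cos, le_div_iff₀ hc'] at this
    linarith
  rcases le_total θ (Real.pi / 2) with h | h
  · left; exact key θ h0 h
  · right
    have := key (Real.pi - θ) (by linarith) (by linarith)
    rwa [Real.cos_pi_sub, Real.sin_pi_sub, neg_div, abs_neg] at this

lemma std_cot {D : ℕ} [NeZero D] {j : ZMod D} (hj : j ≠ 0) :
    (stdAddChar j : ℂ).im / (1 - (stdAddChar j : ℂ).re) =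
      Real.cos (Real.pi * j.val / D) / Real.sin (Real.pi * j.val / D) := by
  have e : (stdAddChar j : ℂ) = Complex.exp (((2 * (Real.pi * j.val / D) : ℝ) : ℂ) * Complex.I) := by
    rw [stdAddChar_apply, toCircle_apply]
    congr 1; push_cast; ring
  have hre := re_pos_one (std_norm j) (std_ne_one hj)
  rw [e, Complex.exp_ofReal_mul_I_re] at hre
  rw [e, Complex.exp_ofReal_mul_I_re, Complex.exp_ofReal_mul_I_im]
  generalize Real.pi * j.val / D = θ at *
  have hc : 1 - Real.cos (2 * θ) = 2 * Real.sin θ ^ 2 := by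
    rw [Real.cos_two_mul, Real.cos_sq']; ring
  have hs : Real.sin θ ≠ 0 := by
    intro h
    rw [h] at hc; norm_num at hc; linarith
  rw [hc, Real.sin_two_mul]
  field_simp

lemma val_angle {D : ℕ} [NeZero D] {j : ZMod D} (hj : j ≠ 0) :
    0 < Real.pi * j.val / D ∧ Real.pi * j.val / D < Real.pi := by
  have h1 : (0 : ℝ) < j.val := by
    exact_mod_cast Nat.pos_of_ne_zero (fun h => hj ((ZMod.val_eq_zero j).1 h))
  have h2 : (j.val : ℝ) < D := by exact_mod_cast ZMod.val_lt j
  have hp := Real.pi_pos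
  have hD : (0 : ℝ) < D := by linarith
  refine ⟨by positivity, ?_⟩
  rw [div_lt_iff₀ hD]
  exact mul_lt_mul_of_pos_left h2 hp

lemma ff_cot_bound {D : ℕ} [NeZero D] {j : ZMod D} (hj : j ≠ 0) {κ : ℝ} (h0 : 0 < κ) :
    |ff (κ * ((stdAddChar j : ℂ).im / (1 - (stdAddChar j : ℂ).re)))| ≤
      ff (κ * D / Real.pi / (j.val : ℝ)) + ff (κ * D / Real.pi / ((D : ℝ) - j.val)) := by
  obtain ⟨ha, hb⟩ := val_angle hj
  have h1 : (0 : ℝ) < j.val := by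
    exact_mod_cast Nat.pos_of_ne_zero (fun h => hj ((ZMod.val_eq_zero j).1 h))
  have h2 : (0 : ℝ) < D - j.val := sub_pos.2 (by exact_mod_cast ZMod.val_lt j)
  have hD : (0 : ℝ) < D := by linarith
  have hp := Real.pi_pos
  rw [ff_abs, std_cot hj, abs_mul, abs_of_pos h0]
  have n1 : 0 ≤ ff (κ * D / Real.pi / (j.val : ℝ)) := ff_nonneg (by positivity)
  have n2 : 0 ≤ ff (κ * D / Real.pi / ((D : ℝ) - j.val)) := ff_nonneg (by positivity)
  rcases cot_bound ha hb with h | h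
  · have : ff (κ * |Real.cos (Real.pi * j.val / D) / Real.sin (Real.pi * j.val / D)|) ≤
        ff (κ * D / Real.pi / (j.val : ℝ)) := by
      apply ff_mono
      refine (mul_le_mul_of_nonneg_left h h0.le).trans_eq ?_
      field_simp
    linarith
  · have : ff (κ * |Real.cos (Real.pi * j.val / D) / Real.sin (Real.pi * j.val / D)|) ≤
        ff (κ * D / Real.pi / ((D : ℝ) - j.val)) := by
      apply ff_mono
      refine (mul_le_mul_of_nonneg_left h h0.le).trans_eq ?_
      have e : Real.pi - Real.pi * j.val / D = Real.pi * (D - j.val) / D := by field_simp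
      rw [e]
      field_simp
    linarith

lemma sum_val {D : ℕ} [NeZero D] (G : ℕ → ℝ) :
    ∑ j : ZMod D, G j.val = ∑ a ∈ Finset.range D, G a := by
  cases D with
  | zero => exact absurd rfl (NeZero.ne 0)
  | succ n => exact Fin.sum_univ_eq_sum_range G (n + 1)

lemma sum_ff_total {D : ℕ} [NeZero D] {c : ℝ} (hc : 0 ≤ c) :
    ∑ j : ZMod D, (ff (c / (j.val : ℝ)) + ff (c / ((D : ℝ) - j.val))) ≤ 2 * c := by
  rw [sum_val (fun a => ff (c / (a : ℝ)) + ff (c / ((D : ℝ) - a))), Finset.sum_add_distrib]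
  have h1 : ∑ a ∈ Finset.range D, ff (c / (a : ℝ)) ≤ c := by
    obtain ⟨n, rfl⟩ := Nat.exists_eq_succ_of_ne_zero (NeZero.ne D)
    rw [Finset.sum_range_succ']
    simpa [ff_zero] using sum_ff_le' hc n
  have h2 : ∑ a ∈ Finset.range D, ff (c / ((D : ℝ) - a)) ≤ c := by
    rw [← Finset.sum_range_reflect]
    refine le_of_eq_of_le ?_ (sum_ff_le' hc D)
    refine Finset.sum_congr rfl fun a ha => ?_
    have := Finset.mem_range.1 ha
    rw [Nat.sub_sub, Nat.cast_sub (by omega)]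
    congr 2
    push_cast; ring
  linarith

lemma odd_im {D : ℕ} (hD : 2 ≤ D) {c : ℂ} (hc : c ^ 2 = -(D : ℂ)) : |c.im| = Real.sqrt D := by
  have hD2 : (2 : ℝ) ≤ D := by exact_mod_cast hD
  have him : c.im ^ 2 = D := by
    have h1 := congrArg Complex.re hc
    have h2 := congrArg Complex.im hc
    simp [pow_two] at h1 h2
    have h3 : c.re * c.im = 0 := by linarith
    rcases mul_eq_zero.1 h3 with h | h
    · rw [h] at h1; nlinarith
    · rw [h] at h1; nlinarith
  rw [← him, Real.sqrt_sq_eq_abs]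

lemma odd_bound_three (χ : DirichletCharacter ℝ 3)
    (hq : ∀ a : ZMod 3, χ a = 0 ∨ χ a = 1 ∨ χ a = -1) (c : ℂ) (hc : c ^ 2 = -((3 : ℕ) : ℂ))
    (hcn : ∀ n : ℕ, c * (χ (n : ZMod 3) : ℝ) = ∑ j : ZMod 3, (χ j : ℂ) * (stdAddChar j : ℂ) ^ n)
    {S : ℝ} (hS : Tendsto (fun N : ℕ => ∑ n ∈ Finset.range N, χ (n : ZMod 3) / (n : ℝ)) atTop (𝓝 S)) :
    S ≤ 1 + Real.log 3 / 2 := by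
  have hχ0 : χ 0 = 0 := χ.map_zero' (by omega)
  have habs := odd_im (by norm_num) hc
  have hcS := L_eq (by omega) χ c hcn hS
  have h1 := congrArg Complex.im hcS
  simp only [Complex.im_sum, Complex.im_mul_ofReal, Complex.im_ofReal_mul, Complex.neg_im,
      Complex.log_im] at h1
  have hj : ∀ j : ZMod 3, j ≠ 0 → |χ j * -(1 - (stdAddChar j : ℂ)).arg| ≤ 1 := by
    intro j hj
    rw [abs_mul, abs_neg]
    refine mul_le_one₀ (chi_abs_le χ hq j) (abs_nonneg _) ?_
    rw [arg_one_sub (re_pos_one (std_norm j) (std_ne_one hj)), neg_div, Real.arctan_neg, abs_neg,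
      std_cot hj]
    refine (abs_arctan_le _).trans ?_
    obtain ⟨ha, hb⟩ := val_angle hj
    have hp := Real.pi_gt_three
    have h1 : (1 : ℝ) ≤ j.val := by
      exact_mod_cast Nat.pos_of_ne_zero (fun h => hj ((ZMod.val_eq_zero j).1 h))
    have h2 : (j.val : ℝ) ≤ 2 := by
      have := ZMod.val_lt j
      exact_mod_cast (by omega : j.val ≤ 2)
    push_cast at ha hb ⊢
    rcases cot_bound ha hb with h | h
    · refine h.trans ?_
      rw [div_le_one ha]; nlinarith
    · refine h.trans ?_
      rw [div_le_one (by linarith)]; nlinarith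
  have h2 : Real.sqrt 3 * S ≤ 2 := by
    calc Real.sqrt 3 * S ≤ |c.im * S| := by
          rw [abs_mul, habs]; push_cast
          exact mul_le_mul_of_nonneg_left (le_abs_self _) (Real.sqrt_nonneg _)
      _ ≤ 2 := by
          rw [h1, ← Finset.sum_erase (a := (0 : ZMod 3)) _ (by simp [hχ0])]
          refine (Finset.abs_sum_le_sum_abs _ _).trans ?_
          refine (Finset.sum_le_sum fun j hj' => hj j (Finset.ne_of_mem_erase hj')).trans ?_
          rw [Finset.sum_const, Finset.card_erase_of_mem (Finset.mem_univ _), Finset.card_univ,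
            ZMod.card]
          norm_num
  have h3 : (1.7 : ℝ) ≤ Real.sqrt 3 := Real.le_sqrt_of_sq_le (by norm_num)
  have h4 : (1 : ℝ) ≤ Real.log 3 := by
    rw [Real.le_log_iff_exp_le (by norm_num)]
    linarith [Real.exp_one_lt_d9]
  by_contra hcon
  push Not at hcon
  nlinarith

lemma odd_bound {D : ℕ} [NeZero D] (hD : 4 ≤ D) (χ : DirichletCharacter ℝ D)
    (hq : ∀ a : ZMod D, χ a = 0 ∨ χ a = 1 ∨ χ a = -1) (c : ℂ) (hc : c ^ 2 = -(D : ℂ))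
    (hcn : ∀ n : ℕ, c * (χ (n : ZMod D) : ℝ) = ∑ j : ZMod D, (χ j : ℂ) * (stdAddChar j : ℂ) ^ n)
    {S : ℝ} (hS : Tendsto (fun N : ℕ => ∑ n ∈ Finset.range N, χ (n : ZMod D) / (n : ℝ)) atTop (𝓝 S)) :
    S ≤ 1 + Real.log D / 2 := by
  have hχ0 : χ 0 = 0 := χ.map_zero' (by omega)
  have hDpos : (0 : ℝ) < D := by exact_mod_cast (by omega : 0 < D)
  have hD4 : (4 : ℝ) ≤ D := by exact_mod_cast hD
  have habs := odd_im (by omega) hc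
  set s : ℝ := Real.sqrt D with hs
  have hs0 : 0 < s := Real.sqrt_pos.2 hDpos
  have hss : s ^ 2 = D := Real.sq_sqrt hDpos.le
  have hs2 : 2 ≤ s := Real.le_sqrt_of_sq_le (by linarith)
  obtain ⟨κ, hκ⟩ : ∃ κ : ℝ, κ = 3 / (2 * s) := ⟨_, rfl⟩
  have hκ0 : 0 < κ := by rw [hκ]; positivity
  have hκ1 : κ ≤ 3 / 4 := by rw [hκ, div_le_div_iff₀ (by positivity) (by norm_num)]; linarith
  obtain ⟨r, hr⟩ : ∃ r : ℝ, r = (1 - κ) / (1 + κ) := ⟨_, rfl⟩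
  obtain ⟨l, hl⟩ : ∃ l : ℝ, l = 2 * κ / (1 - κ ^ 2) := ⟨_, rfl⟩
  have hr0 : 0 < r := by rw [hr]; apply div_pos <;> linarith
  have hr1 : r < 1 := by rw [hr, div_lt_one (by linarith)]; linarith
  have hl0 : 0 < l := by rw [hl]; apply div_pos <;> nlinarith
  -- main term T
  have hT := hasSum_L χ c hcn hr0.le hr1
  have hmaj : HasSum (fun n : ℕ => r ^ n / n) (-Real.log (1 - r)) := hasSum_log hr0 hr1
  have hle : ∀ n : ℕ, |χ (n : ZMod D) / n * r ^ n| ≤ r ^ n / n := by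
    intro n
    rw [abs_mul, abs_div, abs_of_nonneg (pow_nonneg hr0.le n), Nat.abs_cast, div_mul_eq_mul_div]
    gcongr
    exact mul_le_of_le_one_left (by positivity) (chi_abs_le χ hq _)
  have hsumm : Summable (fun n : ℕ => χ (n : ZMod D) / n * r ^ n) :=
    Summable.of_abs (Summable.of_nonneg_of_le (fun _ => abs_nonneg _) hle hmaj.summable)
  set T : ℝ := ∑' n : ℕ, χ (n : ZMod D) / n * r ^ n with hTdef
  have hTle : T ≤ -Real.log (1 - r) :=
    hasSum_le (fun n => (le_abs_self _).trans (hle n)) hsumm.hasSum hmaj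
  have hcT : c * T = ∑ j : ZMod D, (χ j : ℂ) * (-Complex.log (1 - r * (stdAddChar j : ℂ))) := by
    rw [← hT.tsum_eq, tsum_mul_left, hTdef, Complex.ofReal_tsum]
  -- main term M
  have hM := hasSum_M χ c hcn hr0.le hr1
  have hgeo : HasSum (fun n : ℕ => r ^ n) (1 - r)⁻¹ := hasSum_geometric_of_lt_one hr0.le hr1
  have hleM : ∀ n : ℕ, |χ (n : ZMod D) * r ^ n| ≤ r ^ n := by
    intro n
    rw [abs_mul, abs_of_nonneg (pow_nonneg hr0.le n)]
    exact mul_le_of_le_one_left (by positivity) (chi_abs_le χ hq _)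
  have hsummM : Summable (fun n : ℕ => χ (n : ZMod D) * r ^ n) :=
    Summable.of_abs (Summable.of_nonneg_of_le (fun _ => abs_nonneg _) hleM hgeo.summable)
  set M : ℝ := ∑' n : ℕ, χ (n : ZMod D) * r ^ n with hMdef
  have hMle : M ≤ (1 - r)⁻¹ - 1 := by
    have h1 : HasSum (fun n : ℕ => χ ((n + 1 : ℕ) : ZMod D) * r ^ (n + 1)) M := by
      have := (hasSum_nat_add_iff' 1).2 hsummM.hasSum
      simpa [hχ0] using this
    have h2 : HasSum (fun n : ℕ => r ^ (n + 1)) ((1 - r)⁻¹ - 1) := by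
      have := (hasSum_nat_add_iff' 1).2 hgeo
      simpa using this
    exact hasSum_le (fun n => (le_abs_self _).trans (hleM (n + 1))) h1 h2
  have hcM : c * M = ∑ j : ZMod D, (χ j : ℂ) * (1 - r * (stdAddChar j : ℂ))⁻¹ := by
    rw [← hM.tsum_eq, tsum_mul_left, hMdef, Complex.ofReal_tsum]
  have hcS := L_eq (by omega) χ c hcn hS
  have hdiff : c.im * (S - T - l * M) = ∑ j ∈ Finset.univ.erase (0 : ZMod D), χ j *
      ff (κ * ((stdAddChar j : ℂ).im / (1 - (stdAddChar j : ℂ).re))) := by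
    have h1 := congrArg Complex.im hcS
    have h2 := congrArg Complex.im hcT
    have h3 := congrArg Complex.im hcM
    simp only [Complex.im_sum, Complex.im_mul_ofReal, Complex.im_ofReal_mul, Complex.neg_im,
      Complex.log_im] at h1 h2 h3
    rw [show c.im * (S - T - l * M) = c.im * S - c.im * T - l * (c.im * M) by ring, h1, h2, h3,
      Finset.mul_sum, ← Finset.sum_sub_distrib, ← Finset.sum_sub_distrib,
      ← Finset.sum_erase (a := (0 : ZMod D)) _ (by simp [hχ0])]
    refine Finset.sum_congr rfl fun j hj => ?_
    rw [← odd_term (std_norm j) (std_ne_one (Finset.ne_of_mem_erase hj)) hκ0 (by linarith) hr hl]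
    ring
  have hpi := Real.pi_pos
  have hbd : s * (S - T - l * M) ≤ 2 * (κ * D / Real.pi) := by
    calc s * (S - T - l * M) ≤ |c.im * (S - T - l * M)| := by
          rw [abs_mul, habs]; exact mul_le_mul_of_nonneg_left (le_abs_self _) hs0.le
      _ ≤ ∑ j ∈ Finset.univ.erase (0 : ZMod D), (ff (κ * D / Real.pi / (j.val : ℝ)) +
            ff (κ * D / Real.pi / ((D : ℝ) - j.val))) := by
          rw [hdiff]
          refine (Finset.abs_sum_le_sum_abs _ _).trans (Finset.sum_le_sum fun j hj => ?_)
          rw [abs_mul]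
          exact (mul_le_of_le_one_left (abs_nonneg _) (chi_abs_le χ hq _)).trans
            (ff_cot_bound (Finset.ne_of_mem_erase hj) hκ0)
      _ ≤ ∑ j : ZMod D, (ff (κ * D / Real.pi / (j.val : ℝ)) +
            ff (κ * D / Real.pi / ((D : ℝ) - j.val))) := by
          refine Finset.sum_le_sum_of_subset_of_nonneg (Finset.erase_subset _ _) fun j _ _ => ?_
          have h2 : (0 : ℝ) < D - j.val := sub_pos.2 (by exact_mod_cast ZMod.val_lt j)
          exact add_nonneg (ff_nonneg (by positivity)) (ff_nonneg (by positivity))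
      _ ≤ _ := sum_ff_total (by positivity)
  have hST : S - T - l * M ≤ 3 / Real.pi := by
    have e : 2 * (κ * D / Real.pi) = s * (3 / Real.pi) := by
      rw [hκ, ← hss]; field_simp
    rw [e] at hbd
    exact le_of_mul_le_mul_left hbd hs0
  -- closed forms
  have e1 : 1 - r = 2 * κ / (1 + κ) := by rw [hr]; field_simp; ring
  have hlM : l * M ≤ 1 / (1 + κ) := by
    refine (mul_le_mul_of_nonneg_left hMle hl0.le).trans_eq ?_
    have h1 : 1 - κ ≠ 0 := by linarith
    have h2 : 1 - κ ^ 2 = (1 - κ) * (1 + κ) := by ring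
    rw [e1, hl, h2]; field_simp; ring
  have hlogT : -Real.log (1 - r) = Real.log (1 + κ) + Real.log s - Real.log 3 := by
    rw [e1, hκ]
    have h1 : 2 * (3 / (2 * s)) / (1 + 3 / (2 * s)) = 3 / (s * (1 + 3 / (2 * s))) := by field_simp
    rw [h1, Real.log_div (by norm_num) (by positivity), Real.log_mul (by positivity) (by positivity)]
    ring
  have hlogs : Real.log s = Real.log D / 2 := by rw [hs, Real.log_sqrt hDpos.le]
  have hlogκ : Real.log (1 + κ) ≤ Real.log (7 / 4) + (1 + κ) * (4 / 7) - 1 := by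
    have h1 := Real.log_le_sub_one_of_pos (x := (1 + κ) / (7 / 4)) (by positivity)
    rw [Real.log_div (by positivity) (by norm_num)] at h1
    linarith
  have hconv : (1 + κ) * (4 / 7) + 1 / (1 + κ) ≤ 11 / 7 := by
    have h1 : 0 < 1 + κ := by linarith
    have : 1 / (1 + κ) ≤ 11 / 7 - (1 + κ) * (4 / 7) := by
      rw [div_le_iff₀ h1]; nlinarith
    linarith
  have hnum : 8 / 15 ≤ Real.log 3 - Real.log (7 / 4) := by
    rw [← Real.log_div (by norm_num) (by norm_num)]
    have h1 : (8 : ℝ) ≤ Real.log ((3 / (7 / 4)) ^ 15) := by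
      rw [Real.le_log_iff_exp_le (by norm_num)]
      have h2 : Real.exp 8 = Real.exp 1 ^ 8 := by rw [← Real.exp_nat_mul]; norm_num
      rw [h2]
      calc Real.exp 1 ^ 8 ≤ (2.7182818286 : ℝ) ^ 8 :=
            pow_le_pow_left₀ (Real.exp_pos 1).le Real.exp_one_lt_d9.le 8
        _ ≤ _ := by norm_num
    rw [Real.log_pow] at h1
    push_cast at h1
    linarith
  have hpi3 : 3 / Real.pi ≤ 0.956 := by
    rw [div_le_iff₀ hpi]; nlinarith [Real.pi_gt_d2]
  norm_num at hpi3 hnum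
  linarith

end Watson

/-- Lemma 3.2(b) (Watson): if `χ` is a primitive quadratic nonprincipal Dirichlet character
modulo `D ≥ 2` (taking only the values `−1, 0, 1`), then the conditionally convergent series
`L(1, χ) = ∑_{n ≥ 1} χ(n)/n` converges and is at most `1 + (1/2)·ln D`. -/
theorem watson_L_one_bound (D : ℕ) (hD : 2 ≤ D) (χ : DirichletCharacter ℝ D)
    (hnp : χ ≠ 1) (hprim : χ.IsPrimitive)
    (hquad : ∀ a : ZMod D, χ a = 0 ∨ χ a = 1 ∨ χ a = -1) :
    ∃ S : ℝ,
      Filter.Tendsto (fun N : ℕ => ∑ n ∈ Finset.Icc 1 N, χ (n : ZMod D) / (n : ℝ))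
        Filter.atTop (nhds S) ∧ S ≤ 1 + Real.log D / 2 := by
  haveI : NeZero D := ⟨by omega⟩
  obtain ⟨c, hc, hcn⟩ := Watson.exists_gauss χ hprim hquad
  have hDC : (D : ℂ) ≠ 0 := by exact_mod_cast (by omega : D ≠ 0)
  have hχ1 : χ (-1) = 1 ∨ χ (-1) = -1 := by
    have h : χ (-1) * χ (-1) = 1 := by rw [← map_mul]; simp
    exact mul_self_eq_one_iff.1 h
  have hc0 : c ≠ 0 := by
    rintro rfl
    rcases hχ1 with h | h <;> rw [h] at hc <;> norm_num at hc <;> first | omega | exact hDC hc.symm | exact hDC hc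
  obtain ⟨S, hS⟩ := Watson.exists_lim (by omega) χ c hc0 hcn
  refine ⟨S, ?_, ?_⟩
  · refine ((Filter.tendsto_add_atTop_iff_nat 1).2 hS).congr fun N => ?_
    rw [Finset.range_eq_Ico, ← Finset.sum_subset (s₁ := Finset.Icc 1 N)]
    · intro x hx
      simp only [Finset.mem_Icc, Finset.mem_Ico] at hx ⊢; omega
    · intro x hx hx2
      simp only [Finset.mem_Icc, Finset.mem_Ico] at hx hx2
      have : x = 0 := by omega
      simp [this]
  · rcases hχ1 with h | h
    · rw [h] at hc
      exact Watson.even_bound hD χ hnp hquad c (by simpa using hc) hcn hS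
    · rw [h] at hc
      have hc' : c ^ 2 = -(D : ℂ) := by simpa using hc
      rcases (by omega : D = 2 ∨ D = 3 ∨ 4 ≤ D) with h2 | h3 | h4
      · subst h2
        have : (-1 : ZMod 2) = 1 := by decide
        rw [this, map_one] at h
        norm_num at h
      · subst h3
        exact_mod_cast Watson.odd_bound_three χ hquad c hc' hcn hS
      · exact Watson.odd_bound h4 χ hquad c hc' hcn hS
end

section
/- Let L be a positive definite, integral, strongly square free, totally-reflective ℤ-lattice of rank 3, and write det L = q₁⋯q_s with pairwise distinct primes q₁, …, q_s. Then s ≤ 10. -/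
open Matrix

/-- The bilinear form attached to a Gram matrix `G` on `ℤ^m`. -/
def Bf {m : ℕ} (G : Matrix (Fin m) (Fin m) ℤ) (x y : Fin m → ℤ) : ℤ :=
  x ⬝ᵥ G.mulVec y

/-- A vector of the lattice `ℤ^m` is primitive if it is not a proper multiple of a lattice
vector. -/
def PrimVec {m : ℕ} (v : Fin m → ℤ) : Prop :=
  ∀ c : ℤ, 1 < c → ¬∃ w : Fin m → ℤ, c • w = v

/-- `v` is a root of the lattice `(ℤ^m, G)`: it is nonzero, primitive, and the associated
reflection `x ↦ x − (2·b(x,v)/b(v,v))·v` maps the lattice into itself. -/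
def IsRootM {m : ℕ} (G : Matrix (Fin m) (Fin m) ℤ) (v : Fin m → ℤ) : Prop :=
  v ≠ 0 ∧ PrimVec v ∧
    ∀ x : Fin m → ℤ, ∃ y : Fin m → ℤ, ∀ i,
      (y i : ℚ) = (x i : ℚ) - 2 * (Bf G x v : ℚ) / (Bf G v v : ℚ) * (v i : ℚ)

/-- The lattice `(ℤ^m, G)` is reflective if its roots span a sublattice of full rank. -/
def ReflectiveM {m : ℕ} (G : Matrix (Fin m) (Fin m) ℤ) : Prop :=
  Module.finrank ℤ (Submodule.span ℤ {v : Fin m → ℤ | IsRootM G v}) = m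

/-- Positive definiteness of the Gram matrix `G`. -/
def PosDefM {m : ℕ} (G : Matrix (Fin m) (Fin m) ℤ) : Prop :=
  ∀ v : Fin m → ℤ, v ≠ 0 → 0 < Bf G v v

/-- Two integral lattices, given by Gram matrices, are in the same genus if the Gram
matrices are congruent over the ring `ℤ_p` of `p`-adic integers for every prime `p`. -/
def SameGenusM {m : ℕ} (G₁ G₂ : Matrix (Fin m) (Fin m) ℤ) : Prop :=
  ∀ (p : ℕ) [Fact p.Prime],
    ∃ S : Matrix (Fin m) (Fin m) ℤ_[p], IsUnit S.det ∧
      Sᵀ * G₁.map (Int.cast : ℤ → ℤ_[p]) * S = G₂.map (Int.cast : ℤ → ℤ_[p])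

/-- The lattice `(ℤ^m, G)` is totally-reflective if every lattice in its genus is
reflective. -/
def TotallyReflectiveM {m : ℕ} (G : Matrix (Fin m) (Fin m) ℤ) : Prop :=
  ∀ G' : Matrix (Fin m) (Fin m) ℤ, G'.IsSymm → PosDefM G' → SameGenusM G G' → ReflectiveM G'

/-- The lattice `(ℤ^m, G)` is square free: all elementary divisors of `G` are square free. -/
def SquareFreeM {m : ℕ} (G : Matrix (Fin m) (Fin m) ℤ) : Prop :=
  ∃ (S T : Matrix (Fin m) (Fin m) ℤ) (d : Fin m → ℤ),
    IsUnit S.det ∧ IsUnit T.det ∧ S * G * T = Matrix.diagonal d ∧ ∀ i, Squarefree (d i)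

/-- Strongly square free: square free and `v_p(det) ≤ m/2` for every prime `p`. -/
def StronglySquareFreeM {m : ℕ} (G : Matrix (Fin m) (Fin m) ℤ) : Prop :=
  SquareFreeM G ∧ ∀ p : ℕ, p.Prime → (G.det.natAbs).factorization p ≤ m / 2


/-! ### Number theory: a small prime not dividing the determinant -/

lemma nt_prod_ge (S : Finset ℕ) (hS : ∀ p ∈ S, p.Prime) (hc : 11 ≤ S.card) :
    200560490130 ≤ ∏ p ∈ S, p := by
  classical
  set T : Finset ℕ := (Finset.range 32).filter Nat.Prime with hT
  have hTc : T.card = 11 := by rw [hT]; decide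
  have hTp : ∏ p ∈ T, p = 200560490130 := by rw [hT]; decide
  have h1 : (∏ p ∈ S ∩ T, p) * ∏ p ∈ S \ T, p = ∏ p ∈ S, p := by
    rw [mul_comm, ← Finset.prod_union]
    · congr 1; ext x; simp; tauto
    · exact Finset.disjoint_left.2 (by intro x; simp; tauto)
  have h2 : (∏ p ∈ S ∩ T, p) * ∏ p ∈ T \ S, p = ∏ p ∈ T, p := by
    rw [mul_comm, ← Finset.prod_union]
    · congr 1; ext x; simp; tauto
    · exact Finset.disjoint_left.2 (by intro x; simp; tauto)
  have hcard : (T \ S).card ≤ (S \ T).card := by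
    have e1 := Finset.card_sdiff_add_card_inter T S
    have e2 := Finset.card_sdiff_add_card_inter S T
    rw [Finset.inter_comm] at e2
    omega
  have h3 : ∏ p ∈ T \ S, p ≤ 31 ^ (T \ S).card := by
    apply Finset.prod_le_pow_card
    intro x hx
    simp [hT] at hx
    omega
  have h4 : 32 ^ (S \ T).card ≤ ∏ p ∈ S \ T, p := by
    apply Finset.pow_card_le_prod
    intro x hx
    simp only [hT, Finset.mem_sdiff, Finset.mem_filter, Finset.mem_range, not_and] at hx
    by_contra h
    exact hx.2 (by omega) (hS x hx.1)
  have h5 : 31 ^ (T \ S).card ≤ 32 ^ (S \ T).card :=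
    (Nat.pow_le_pow_left (by norm_num) _).trans (Nat.pow_le_pow_right (by norm_num) hcard)
  rw [← hTp, ← h1, ← h2]
  exact Nat.mul_le_mul_left _ (h3.trans (h5.trans h4))

/-- Product of the primes in `[7, n]`. -/
def QP (n : ℕ) : ℕ := ∏ p ∈ (Finset.Icc 7 n).filter Nat.Prime, p

lemma QP_mono {m n : ℕ} (h : m ≤ n) : QP m ≤ QP n := by
  unfold QP
  apply Nat.le_of_dvd
  · exact Finset.prod_pos (fun p hp => (Finset.mem_filter.1 hp).2.pos)
  · apply Finset.prod_dvd_prod_of_subset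
    intro x; simp; intros; refine ⟨⟨?_, ?_⟩, ?_⟩ <;> first | assumption | omega

lemma QP_ge (n : ℕ) (hn : 43 ≤ n) : 5 * (n + 1) ^ 6 < QP n := by
  induction n using Nat.strong_induction_on with
  | _ n ih =>
    by_cases h : n ≤ 127
    · have h1 : 5 * (n + 1) ^ 6 ≤ 5 * (127 + 1) ^ 6 := by gcongr
      have h2 : 5 * (127 + 1) ^ 6 < QP 43 := by unfold QP; simp +decide [Finset.prod_filter, Finset.prod_Icc_succ_top]
      exact h1.trans_lt (h2.trans_le (QP_mono hn))
    · obtain ⟨r, hr, hr1, hr2⟩ := Nat.exists_prime_lt_and_le_two_mul (n / 2) (by omega)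
      have hrn : r ≤ n := by omega
      have h3 := ih (r - 1) (by omega) (by omega)
      have h4 : QP r = r * QP (r - 1) := by
        unfold QP
        have : (Finset.Icc 7 r).filter Nat.Prime
            = insert r ((Finset.Icc 7 (r - 1)).filter Nat.Prime) := by
          ext x
          simp only [Finset.mem_filter, Finset.mem_Icc, Finset.mem_insert]
          constructor
          · rintro ⟨⟨ha, hb⟩, hc⟩
            by_cases hx : x = r
            · exact Or.inl hx
            · exact Or.inr ⟨⟨ha, by omega⟩, hc⟩
          · rintro (rfl | ⟨⟨ha, hb⟩, hc⟩)
            · exact ⟨⟨by omega, le_rfl⟩, hr⟩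
            · exact ⟨⟨ha, by omega⟩, hc⟩
        rw [this, Finset.prod_insert]
        simp; omega
      have h5 : r - 1 + 1 = r := by omega
      rw [h5] at h3
      calc 5 * (n + 1) ^ 6 ≤ 5 * (2 * r) ^ 6 := by gcongr; omega
        _ = 64 * (5 * r ^ 6) := by ring
        _ ≤ r * (5 * r ^ 6) := by gcongr; omega
        _ < r * QP (r - 1) := by gcongr; omega
        _ = QP r := h4.symm
        _ ≤ QP n := QP_mono hrn

lemma nt_main (d : ℕ) (hd : 200560490130 ≤ d) :
    ∃ p : ℕ, p.Prime ∧ 7 ≤ p ∧ ¬ p ∣ d ∧ 5 * p ^ 6 < d := by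
  classical
  have hex : ∃ p : ℕ, p.Prime ∧ 7 ≤ p ∧ ¬ p ∣ d := by
    obtain ⟨p, hp, hpp⟩ := Nat.exists_infinite_primes (d + 7)
    refine ⟨p, hpp, by omega, fun h => ?_⟩
    have := Nat.le_of_dvd (by omega) h
    omega
  obtain ⟨hp, hp7, hpd⟩ := Nat.find_spec hex
  have hmin := fun m (hm : m < Nat.find hex) => Nat.find_min hex hm
  set p := Nat.find hex
  refine ⟨p, hp, hp7, hpd, ?_⟩
  by_cases h : p ≤ 43
  · have : 5 * p ^ 6 ≤ 5 * 43 ^ 6 := by gcongr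
    omega
  · have h1 := QP_ge (p - 1) (by omega)
    have h2 : QP (p - 1) ∣ d := by
      unfold QP
      apply Finset.prod_primes_dvd
      · intro a ha; exact (Finset.mem_filter.1 ha).2.prime
      · intro a ha
        simp only [Finset.mem_filter, Finset.mem_Icc] at ha
        by_contra hc
        exact hmin a (by omega) ⟨ha.2, ha.1.1, hc⟩
    have h3 := Nat.le_of_dvd (by omega) h2
    have h5 : p - 1 + 1 = p := by omega
    rw [h5] at h1
    omega

/-- A diagonal ternary form over `ZMod p`, `p ≥ 7`, has a zero with nonzero coordinates. -/
lemma conic_aux {F : Type*} [Field F] (h15 : (15 : F) ≠ 0) (h2 : (2 : F) ≠ 0) (A B x0 : F)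
    (hB : B ≠ 0) (h : A * x0 ^ 2 = 1) : ∃ x y : F, x ≠ 0 ∧ y ≠ 0 ∧ A * x ^ 2 + B * y ^ 2 = 1 := by
  have hx0 : x0 ≠ 0 := by rintro rfl; simp at h
  have key : ∃ t : F, t ≠ 0 ∧ 1 + B * t ^ 2 ≠ 0 ∧ 1 - B * t ^ 2 ≠ 0 := by
    by_contra hc
    push Not at hc
    have e1 : B ^ 2 = 1 := by
      by_cases h1 : 1 + B * 1 ^ 2 = 0
      · linear_combination (B - 1) * h1
      · have := hc 1 one_ne_zero h1
        linear_combination (-B - 1) * this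
    have e2 : 16 * B ^ 2 = 1 := by
      by_cases h1 : 1 + B * 2 ^ 2 = 0
      · linear_combination (4 * B - 1) * h1
      · have := hc 2 h2 h1
        linear_combination (-4 * B - 1) * this
    exact h15 (by linear_combination e2 - 16 * e1)
  obtain ⟨t, ht, h1, h3⟩ := key
  refine ⟨x0 * (1 - B * t ^ 2) / (1 + B * t ^ 2), 2 * t / (1 + B * t ^ 2), ?_, ?_, ?_⟩
  · exact div_ne_zero (mul_ne_zero hx0 h3) h1
  · exact div_ne_zero (mul_ne_zero h2 ht) h1
  · field_simp
    linear_combination (1 - B * t ^ 2) ^ 2 * h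

lemma conic (p : ℕ) [Fact p.Prime] (hp : 7 ≤ p) (a b c : ZMod p) (ha : a ≠ 0) (hb : b ≠ 0)
    (hc : c ≠ 0) : ∃ x y z : ZMod p, x ≠ 0 ∧ y ≠ 0 ∧ z ≠ 0 ∧
      a * x ^ 2 + b * y ^ 2 + c * z ^ 2 = 0 := by
  have hpp : p.Prime := Fact.out
  have nz : ∀ n : ℕ, ¬ p ∣ n → ((n : ℕ) : ZMod p) ≠ 0 := fun n hn h =>
    hn ((ZMod.natCast_eq_zero_iff n p).1 h)
  have h2 : (2 : ZMod p) ≠ 0 := by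
    have := nz 2 (fun h => by have := Nat.le_of_dvd (by norm_num) h; omega)
    exact_mod_cast this
  have h15 : (15 : ZMod p) ≠ 0 := by
    have := nz 15 (fun h => by
      have h' : p ∣ 3 * 5 := h
      rcases (Nat.Prime.dvd_mul hpp).1 h' with h | h <;>
      · have := Nat.le_of_dvd (by norm_num) h; omega)
    exact_mod_cast this
  set A := -a / c with hA
  set B := -b / c with hB
  have hA0 : A ≠ 0 := div_ne_zero (neg_ne_zero.2 ha) hc
  have hB0 : B ≠ 0 := div_ne_zero (neg_ne_zero.2 hb) hc
  have key : ∃ x y : ZMod p, x ≠ 0 ∧ y ≠ 0 ∧ A * x ^ 2 + B * y ^ 2 = 1 := by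
    obtain ⟨x0, y0, h0⟩ : ∃ x0 y0 : ZMod p, A * x0 ^ 2 + B * y0 ^ 2 = 1 := by
      obtain ⟨x, y, h⟩ := FiniteField.exists_root_sum_quadratic
        (f := Polynomial.C A * Polynomial.X ^ 2) (g := Polynomial.C B * Polynomial.X ^ 2
          - Polynomial.C 1)
        (Polynomial.degree_C_mul_X_pow 2 hA0)
        (by rw [Polynomial.degree_sub_C]
            · exact Polynomial.degree_C_mul_X_pow 2 hB0
            · rw [Polynomial.degree_C_mul_X_pow 2 hB0]; norm_num)
        (by rw [ZMod.card]; exact hpp.eq_two_or_odd.resolve_left (by omega))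
      refine ⟨x, y, ?_⟩
      simp at h
      linear_combination h
    by_cases hy : y0 = 0
    · subst hy
      exact conic_aux h15 h2 A B x0 hB0 (by linear_combination h0)
    · by_cases hx : x0 = 0
      · subst hx
        obtain ⟨x, y, h1, h2, h3⟩ := conic_aux h15 h2 B A y0 hA0 (by linear_combination h0)
        exact ⟨y, x, h2, h1, by linear_combination h3⟩
      · exact ⟨x0, y0, hx, hy, h0⟩
  obtain ⟨x, y, hx, hy, h⟩ := key
  refine ⟨x, y, 1, hx, hy, one_ne_zero, ?_⟩
  rw [hA, hB] at h
  field_simp at h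
  linear_combination -h

/-! ### The bilinear form -/

section BfLemmas
variable {G : Matrix (Fin 3) (Fin 3) ℤ}

lemma Bf_expand (G : Matrix (Fin 3) (Fin 3) ℤ) (x y : Fin 3 → ℤ) :
    Bf G x y = x 0 * (G 0 0 * y 0 + G 0 1 * y 1 + G 0 2 * y 2)
      + x 1 * (G 1 0 * y 0 + G 1 1 * y 1 + G 1 2 * y 2)
      + x 2 * (G 2 0 * y 0 + G 2 1 * y 1 + G 2 2 * y 2) := by
  simp [Bf, dotProduct, Matrix.mulVec, Fin.sum_univ_three]

lemma Bf_comm (hG : G.IsSymm) (x y : Fin 3 → ℤ) : Bf G x y = Bf G y x := by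
  rw [Bf_expand, Bf_expand]
  have h1 := hG.apply 0 1
  have h2 := hG.apply 0 2
  have h3 := hG.apply 1 2
  rw [h1, h2, h3]; ring

lemma Bf_add_left (x y z : Fin 3 → ℤ) : Bf G (x + y) z = Bf G x z + Bf G y z := by
  simp [Bf, add_dotProduct]
lemma Bf_sub_left (x y z : Fin 3 → ℤ) : Bf G (x - y) z = Bf G x z - Bf G y z := by
  simp [Bf, sub_dotProduct]
lemma Bf_smul_left (k : ℤ) (x z : Fin 3 → ℤ) : Bf G (k • x) z = k * Bf G x z := by
  simp only [Bf, smul_dotProduct, smul_eq_mul]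
lemma Bf_add_right (x y z : Fin 3 → ℤ) : Bf G z (x + y) = Bf G z x + Bf G z y := by
  simp [Bf, Matrix.mulVec_add, dotProduct_add]
lemma Bf_sub_right (x y z : Fin 3 → ℤ) : Bf G z (x - y) = Bf G z x - Bf G z y := by
  simp [Bf, Matrix.mulVec_sub, dotProduct_sub]
lemma Bf_smul_right (k : ℤ) (x z : Fin 3 → ℤ) : Bf G z (k • x) = k * Bf G z x := by
  simp only [Bf, Matrix.mulVec_smul, dotProduct_smul, smul_eq_mul]

/-- Pulling back the form along a matrix. -/
lemma Bf_mulVec (A : Matrix (Fin 3) (Fin 3) ℤ) (x y : Fin 3 → ℤ) :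
    Bf G (A *ᵥ x) (A *ᵥ y) = Bf (Aᵀ * G * A) x y := by
  simp only [Bf]
  rw [← Matrix.mulVec_mulVec, ← Matrix.mulVec_mulVec, Matrix.dotProduct_mulVec x,
    Matrix.vecMul_transpose]

/-- Pre-roots: not necessarily primitive vectors with integral reflection. -/
def PR (G : Matrix (Fin 3) (Fin 3) ℤ) (v : Fin 3 → ℤ) : Prop :=
  v ≠ 0 ∧ ∀ x, Bf G v v ∣ 2 * Bf G x v

lemma prim_bezout (v : Fin 3 → ℤ) (hv : v ≠ 0) (hp : PrimVec v) :
    ∃ r : Fin 3 → ℤ, r 0 * v 0 + r 1 * v 1 + r 2 * v 2 = 1 := by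
  set g : ℤ := gcd (gcd (v 0) (v 1)) (v 2) with hg
  have hg0 : g ≠ 0 := by
    intro h
    rw [hg, gcd_eq_zero_iff, gcd_eq_zero_iff] at h
    apply hv; ext i; fin_cases i <;> simp [h]
  have hgn : 0 ≤ g := by
    rw [hg, ← Int.coe_gcd]; positivity
  have hd0 : g ∣ v 0 := (gcd_dvd_left _ _).trans (gcd_dvd_left _ _)
  have hd1 : g ∣ v 1 := (gcd_dvd_left _ _).trans (gcd_dvd_right _ _)
  have hd2 : g ∣ v 2 := gcd_dvd_right _ _
  have hg1 : g = 1 := by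
    by_contra hne
    apply hp g (by omega)
    obtain ⟨a, ha⟩ := hd0
    obtain ⟨b, hb⟩ := hd1
    obtain ⟨c, hc⟩ := hd2
    refine ⟨![a, b, c], ?_⟩
    ext i; fin_cases i <;> simp [ha, hb, hc]
  obtain ⟨x, y, hxy⟩ := exists_gcd_eq_mul_add_mul (v 0) (v 1)
  obtain ⟨z, w, hzw⟩ := exists_gcd_eq_mul_add_mul (gcd (v 0) (v 1)) (v 2)
  refine ⟨![x * z, y * z, w], ?_⟩
  simp
  rw [← hg, hg1, hxy] at hzw
  linear_combination -hzw

lemma IsRootM.pr (hpos : PosDefM G) {v : Fin 3 → ℤ} (h : IsRootM G v) : PR G v := by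
  obtain ⟨h0, hp, hr⟩ := h
  refine ⟨h0, fun x => ?_⟩
  obtain ⟨r, hr1⟩ := prim_bezout v h0 hp
  obtain ⟨y, hy⟩ := hr x
  have hN := hpos v h0
  have hNq : (Bf G v v : ℚ) ≠ 0 := by exact_mod_cast hN.ne'
  refine ⟨r 0 * (x 0 - y 0) + r 1 * (x 1 - y 1) + r 2 * (x 2 - y 2), ?_⟩
  have hr1' : (r 0 * v 0 + r 1 * v 1 + r 2 * v 2 : ℚ) = 1 := by exact_mod_cast hr1
  have : (2 * Bf G x v : ℚ) = Bf G v v *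
      (r 0 * (x 0 - y 0) + r 1 * (x 1 - y 1) + r 2 * (x 2 - y 2)) := by
    rw [hy 0, hy 1, hy 2]
    field_simp
    linear_combination (-2 * (Bf G x v : ℚ)) * hr1'
  exact_mod_cast this

lemma PR.reflect (hG : G.IsSymm) {r s : Fin 3 → ℤ} (hr : PR G r) (hs : PR G s) (hpos : PosDefM G)
    (k : ℤ) (hk : k * Bf G r r = 2 * Bf G s r) : PR G (s - k • r) := by
  have hN := hpos r hr.1
  have hnorm : Bf G (s - k • r) (s - k • r) = Bf G s s := by
    simp only [Bf_sub_left, Bf_sub_right, Bf_smul_left, Bf_smul_right]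
    rw [Bf_comm hG r s]
    linear_combination k * hk
  refine ⟨?_, fun x => ?_⟩
  · intro h
    rw [h] at hnorm
    have := hpos s hs.1
    simp [Bf] at hnorm
    simp [Bf] at this
    omega
  · rw [hnorm]
    obtain ⟨m, hm⟩ := hr.2 x
    have : Bf G x (s - k • r) = Bf G (x - m • r) s := by
      simp only [Bf_sub_left, Bf_sub_right, Bf_smul_left, Bf_smul_right]
      have : Bf G r r * (2 * (k * Bf G x r)) = Bf G r r * (2 * (m * Bf G r s)) := by
        rw [Bf_comm hG r s]
        linear_combination 2 * Bf G x r * hk + (2 * Bf G s r) * hm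
      have := mul_left_cancel₀ hN.ne' this
      linarith
    rw [this]
    exact hs.2 _

/-- Coordinates of the cross product; it vanishes iff the vectors are parallel. -/
def Par (r s : Fin 3 → ℤ) : Prop := ∀ i j, r i * s j = r j * s i

lemma cs_strict (hG : G.IsSymm) (hpos : PosDefM G) {r s : Fin 3 → ℤ} (h : ¬ Par r s) (hr : r ≠ 0) :
    Bf G r s ^ 2 < Bf G r r * Bf G s s := by
  have hN := hpos r hr
  have hne : Bf G r r • s - Bf G r s • r ≠ 0 := by
    intro h0
    apply h
    intro i j
    have hi := congrFun h0 i
    have hj := congrFun h0 j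
    simp at hi hj
    have : Bf G r r * (r i * s j) = Bf G r r * (r j * s i) := by
      linear_combination r i * hj - r j * hi
    exact mul_left_cancel₀ hN.ne' this
  have := hpos _ hne
  simp only [Bf_sub_left, Bf_sub_right, Bf_smul_left, Bf_smul_right] at this
  rw [Bf_comm hG s r] at this
  have h2 : 0 < Bf G r r * (Bf G r r * Bf G s s - Bf G r s ^ 2) := by linarith
  have := pos_of_mul_pos_right h2 hN.le
  linarith

lemma half_pair (hG : G.IsSymm) (hpos : PosDefM G) {r s : Fin 3 → ℤ} (hr : PR G r) (hs : PR G s)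
    (e : ℤ) (he : e ^ 2 = 1)
    (h : (Bf G s r = e * Bf G r r ∧ Bf G s s = 2 * Bf G r r) ∨
      (2 * Bf G s r = 3 * e * Bf G r r ∧ Bf G s s = 3 * Bf G r r)) :
    ∃ u v, PR G u ∧ PR G v ∧ Bf G u v = 0 := by
  rcases h with ⟨h1, h2⟩ | ⟨h1, h2⟩
  · refine ⟨s, s - (2 * e) • r, hs, PR.reflect hG hr hs hpos (2 * e) (by rw [h1]; ring), ?_⟩
    rw [Bf_sub_right, Bf_smul_right, h1, h2]
    linear_combination (-2 * Bf G r r) * he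
  · have h3 := PR.reflect hG hr hs hpos (3 * e) (by rw [h1])
    have h4 := PR.reflect hG h3 hs hpos (-1) (by
      simp only [Bf_sub_left, Bf_sub_right, Bf_smul_left, Bf_smul_right]
      rw [Bf_comm hG r s, h2]
      linear_combination (9 * Bf G r r) * he + 6 * e * h1)
    refine ⟨r, _, hr, h4, ?_⟩
    simp only [Bf_sub_right, Bf_smul_right]
    rw [Bf_comm hG r s]
    linear_combination h1

lemma pair_cases (hG : G.IsSymm) (hpos : PosDefM G) {r s : Fin 3 → ℤ} (hr : PR G r) (hs : PR G s)
    (h : ¬ Par r s) : (∃ u v, PR G u ∧ PR G v ∧ Bf G u v = 0) ∨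
      (Bf G r r = Bf G s s ∧ (2 * Bf G r s = Bf G r r ∨ 2 * Bf G r s = - Bf G r r)) := by
  have hcs := cs_strict hG hpos h hr.1
  obtain ⟨n, hn⟩ := hs.2 r
  obtain ⟨m, hm⟩ := hr.2 s
  have hR := hpos r hr.1
  have hS := hpos s hs.1
  rw [Bf_comm hG s r] at hm
  have hnm : n * m < 4 := by
    have : (Bf G r r * Bf G s s) * (n * m) < (Bf G r r * Bf G s s) * 4 := by
      have : (Bf G r r * Bf G s s) * (n * m) = 4 * Bf G r s ^ 2 := by
        linear_combination (-2 * Bf G r s) * hn - (Bf G s s * n) * hm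
      linarith
    exact lt_of_mul_lt_mul_left this (by positivity)
  have hnm0 : 0 ≤ n * m := by
    have : 0 ≤ (Bf G r r * Bf G s s) * (n * m) := by
      have : (Bf G r r * Bf G s s) * (n * m) = 4 * Bf G r s ^ 2 := by
        linear_combination (-2 * Bf G r s) * hn - (Bf G s s * n) * hm
      rw [this]; positivity
    by_contra hc
    have : (Bf G r r * Bf G s s) * (n * m) < 0 := mul_neg_of_pos_of_neg (by positivity) (by omega)
    omega
  by_cases hn0 : n = 0
  · left
    refine ⟨r, s, hr, hs, ?_⟩
    rw [hn0] at hn; linarith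
  by_cases hm0 : m = 0
  · left
    refine ⟨r, s, hr, hs, ?_⟩
    rw [hm0] at hm; linarith
  have hn3 : |n| ≤ 3 := by
    have : |n| * |m| ≤ 3 := by rw [← abs_mul, abs_of_nonneg hnm0]; omega
    have := Int.one_le_abs hm0
    nlinarith [abs_nonneg n]
  have hm3 : |m| ≤ 3 := by
    have : |n| * |m| ≤ 3 := by rw [← abs_mul, abs_of_nonneg hnm0]; omega
    have := Int.one_le_abs hn0
    nlinarith [abs_nonneg m]
  rw [abs_le] at hn3 hm3
  have hc := Bf_comm hG s r
  obtain ⟨hn1, hn2⟩ := hn3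
  obtain ⟨hm1, hm2⟩ := hm3
  have A := fun e he hh => half_pair hG hpos hr hs e he hh
  have B := fun e he hh => half_pair hG hpos hs hr e he hh
  have A1 := A 1 (by norm_num)
  have A2 := A (-1) (by norm_num)
  have B1 := B 1 (by norm_num)
  have B2 := B (-1) (by norm_num)
  clear A B
  rw [hc] at A1 A2
  generalize Bf G r s = b at *
  generalize Bf G r r = R at *
  generalize Bf G s s = S at *
  interval_cases n <;> interval_cases m <;> first
    | (exfalso; omega)
    | (right; omega)
    | (left; apply A1; omega)
    | (left; apply A2; omega)
    | (left; apply B1; omega)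
    | (left; apply B2; omega)

/-- determinant of three vectors -/
def D3 (r s t : Fin 3 → ℤ) : ℤ :=
  (r 1 * s 2 - r 2 * s 1) * t 0 + (r 2 * s 0 - r 0 * s 2) * t 1 + (r 0 * s 1 - r 1 * s 0) * t 2

lemma exists_pair (hG : G.IsSymm) (hpos : PosDefM G) {r s t : Fin 3 → ℤ} (hr : PR G r)
    (hs : PR G s) (ht : PR G t) (hD : D3 r s t ≠ 0) :
    ∃ u v, PR G u ∧ PR G v ∧ Bf G u v = 0 := by
  have p1 : ¬ Par r s := by
    intro h; apply hD; unfold D3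
    linear_combination t 0 * h 1 2 + t 1 * h 2 0 + t 2 * h 0 1
  have p2 : ¬ Par r t := by
    intro h; apply hD; unfold D3
    linear_combination -s 0 * h 1 2 - s 1 * h 2 0 - s 2 * h 0 1
  have p3 : ¬ Par s t := by
    intro h; apply hD; unfold D3
    linear_combination r 0 * h 1 2 + r 1 * h 2 0 + r 2 * h 0 1
  rcases pair_cases hG hpos hr hs p1 with h | ⟨n1, h1⟩
  · exact h
  rcases pair_cases hG hpos hr ht p2 with h | ⟨n2, h2⟩
  · exact h
  rcases pair_cases hG hpos hs ht p3 with h | ⟨n3, h3⟩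
  · exact h
  -- choose signs
  obtain ⟨e1, he1, k1⟩ : ∃ e : ℤ, e ^ 2 = 1 ∧ 2 * Bf G r s = e * Bf G r r := by
    rcases h1 with h | h
    · exact ⟨1, by norm_num, by rw [h]; ring⟩
    · exact ⟨-1, by norm_num, by rw [h]; ring⟩
  obtain ⟨e2, he2, k2⟩ : ∃ e : ℤ, e ^ 2 = 1 ∧ 2 * Bf G r t = e * Bf G r r := by
    rcases h2 with h | h
    · exact ⟨1, by norm_num, by rw [h]; ring⟩
    · exact ⟨-1, by norm_num, by rw [h]; ring⟩
  obtain ⟨e3, he3, k3⟩ : ∃ e : ℤ, e ^ 2 = 1 ∧ 2 * Bf G s t = e * Bf G r r := by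
    rcases h3 with h | h
    · exact ⟨1, by norm_num, by rw [h, n1]; ring⟩
    · exact ⟨-1, by norm_num, by rw [h, n1]; ring⟩
  have c1 := Bf_comm hG s r
  have c2 := Bf_comm hG t r
  have c3 := Bf_comm hG t s
  by_cases hsgn : e3 = e1 * e2
  · refine ⟨_, t, PR.reflect hG hr hs hpos e1 (by rw [c1, k1]), ht, ?_⟩
    rw [Bf_sub_left, Bf_smul_left]
    have : 2 * (Bf G s t - e1 * Bf G r t) = 0 := by
      rw [hsgn] at k3
      linear_combination k3 - e1 * k2
    omega
  · exfalso
    have hs' : e3 = - (e1 * e2) := by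
      have : e3 ^ 2 = (e1 * e2) ^ 2 := by rw [mul_pow, he1, he2, he3]; ring
      exact (sq_eq_sq_iff_eq_or_eq_neg.1 this).resolve_left hsgn
    -- `r - e1 s - e2 t` is isotropic
    have hz : Bf G (r - e1 • s - e2 • t) (r - e1 • s - e2 • t) = 0 := by
      simp only [Bf_sub_left, Bf_sub_right, Bf_smul_left, Bf_smul_right]
      rw [c1, c2, c3, ← n2, ← n1]
      rw [hs'] at k3
      linear_combination (-e1) * k1 - e2 * k2 + e1 * e2 * k3 + (-e2 ^ 2 * Bf G r r) * he1 - Bf G r r * he2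
    have hv : r - e1 • s - e2 • t = 0 := by
      by_contra hne
      exact (hpos _ hne).ne' hz
    apply hD
    have v0 := congrFun hv 0
    have v1 := congrFun hv 1
    have v2 := congrFun hv 2
    simp at v0 v1 v2
    unfold D3
    linear_combination (s 1 * t 2 - s 2 * t 1) * v0 + (s 2 * t 0 - s 0 * t 2) * v1
      + (s 0 * t 1 - s 1 * t 0) * v2

lemma reflective_functional (hpos : PosDefM G) (hr : ReflectiveM G) (f : Fin 3 → ℤ) (hf : f ≠ 0) :
    ∃ r, PR G r ∧ f 0 * r 0 + f 1 * r 1 + f 2 * r 2 ≠ 0 := by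
  by_contra hc
  push Not at hc
  let φ : (Fin 3 → ℤ) →ₗ[ℤ] ℤ := Fintype.linearCombination ℤ f
  have hφ : ∀ x, φ x = f 0 * x 0 + f 1 * x 1 + f 2 * x 2 := by
    intro x
    simp [φ, Fintype.linearCombination_apply, Fin.sum_univ_three]; ring
  have hle : Submodule.span ℤ {v : Fin 3 → ℤ | IsRootM G v} ≤ LinearMap.ker φ := by
    rw [Submodule.span_le]
    intro v hv
    simp only [SetLike.mem_coe, LinearMap.mem_ker, hφ]
    exact hc v (IsRootM.pr hpos hv)
  have h1 := Submodule.finrank_mono hle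
  rw [hr] at h1
  have h2 := Submodule.finrank_quotient_add_finrank (LinearMap.ker φ)
  rw [φ.quotKerEquivRange.finrank_eq] at h2
  simp only [Module.finrank_fintype_fun_eq_card, Fintype.card_fin] at h2
  have h3 : Module.finrank ℤ (LinearMap.range φ) = 0 := by omega
  have h4 : LinearMap.range φ = ⊥ := Submodule.finrank_eq_zero.1 h3
  apply hf
  have h5 : φ = 0 := LinearMap.range_eq_bot.1 h4
  ext i
  have := hφ (Pi.single i 1)
  rw [h5] at this
  fin_cases i <;> simpa using this.symm

lemma exists_three (hpos : PosDefM G) (hr : ReflectiveM G) :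
    ∃ r s t, PR G r ∧ PR G s ∧ PR G t ∧ D3 r s t ≠ 0 := by
  obtain ⟨r, hr1, -⟩ := reflective_functional hpos hr ![1, 0, 0] (by
    intro h; simpa using congrFun h 0)
  have hs : ∃ s, PR G s ∧ ¬ Par r s := by
    by_cases h0 : r 0 ≠ 0
    · obtain ⟨s, hs, h⟩ := reflective_functional hpos hr ![r 1, - r 0, 0] (by
        intro h; simpa [h0] using congrFun h 1)
      refine ⟨s, hs, fun hp => h ?_⟩
      simp; linear_combination hp 1 0
    by_cases h1 : r 1 ≠ 0
    · obtain ⟨s, hs, h⟩ := reflective_functional hpos hr ![r 1, - r 0, 0] (by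
        intro h; simpa [h1] using congrFun h 0)
      refine ⟨s, hs, fun hp => h ?_⟩
      simp; linear_combination hp 1 0
    · have h2 : r 2 ≠ 0 := by
        intro h2; push Not at h0 h1
        apply hr1.1; ext i; fin_cases i <;> simp [h0, h1, h2]
      obtain ⟨s, hs, h⟩ := reflective_functional hpos hr ![r 2, 0, - r 0] (by
        intro h; simpa [h2] using congrFun h 0)
      refine ⟨s, hs, fun hp => h ?_⟩
      simp; linear_combination hp 2 0
  obtain ⟨s, hs, hp⟩ := hs
  obtain ⟨t, ht, h⟩ := reflective_functional hpos hr
    ![r 1 * s 2 - r 2 * s 1, r 2 * s 0 - r 0 * s 2, r 0 * s 1 - r 1 * s 0] (by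
      intro h
      have e0 := congrFun h 0
      have e1 := congrFun h 1
      have e2 := congrFun h 2
      simp at e0 e1 e2
      apply hp
      intro i j
      fin_cases i <;> fin_cases j <;> simp <;> linarith)
  exact ⟨r, s, t, hr1, hs, ht, by simpa [D3] using h⟩

end BfLemmas

/-! ### Orthogonal frames of roots -/

lemma exists_prim (C : Fin 3 → ℤ) (hC : C ≠ 0) :
    ∃ (w r : Fin 3 → ℤ) (g : ℤ), g ≠ 0 ∧ (∀ i, C i = g * w i) ∧
      r 0 * w 0 + r 1 * w 1 + r 2 * w 2 = 1 := by
  set g : ℤ := gcd (gcd (C 0) (C 1)) (C 2) with hg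
  have hg0 : g ≠ 0 := by
    intro h
    rw [hg, gcd_eq_zero_iff, gcd_eq_zero_iff] at h
    apply hC; ext i; fin_cases i <;> simp [h]
  obtain ⟨a, ha⟩ : g ∣ C 0 := (gcd_dvd_left _ _).trans (gcd_dvd_left _ _)
  obtain ⟨b, hb⟩ : g ∣ C 1 := (gcd_dvd_left _ _).trans (gcd_dvd_right _ _)
  obtain ⟨c, hc⟩ : g ∣ C 2 := gcd_dvd_right _ _
  obtain ⟨x, y, hxy⟩ := exists_gcd_eq_mul_add_mul (C 0) (C 1)
  obtain ⟨z, w, hzw⟩ := exists_gcd_eq_mul_add_mul (gcd (C 0) (C 1)) (C 2)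
  refine ⟨![a, b, c], ![x * z, y * z, w], g, hg0, ?_, ?_⟩
  · intro i; fin_cases i <;> simp [ha, hb, hc]
  · rw [← hg, hxy] at hzw
    apply mul_left_cancel₀ hg0
    simp
    linear_combination -hzw - x * z * ha - y * z * hb - w * hc

/-- An orthogonal frame of pre-roots. -/
structure Frame (G : Matrix (Fin 3) (Fin 3) ℤ) (v : Fin 3 → Fin 3 → ℤ) : Prop where
  pr : ∀ i, PR G (v i)
  orth : ∀ i j, i ≠ j → Bf G (v i) (v j) = 0
  expand : ∀ x : Fin 3 → ℤ, ∃ k : Fin 3 → ℤ, (∀ i, k i * Bf G (v i) (v i) = 2 * Bf G x (v i)) ∧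
    (2 : ℤ) • x = k 0 • v 0 + k 1 • v 1 + k 2 • v 2

lemma exists_frame {G : Matrix (Fin 3) (Fin 3) ℤ} (hG : G.IsSymm) (hpos : PosDefM G)
    (hr : ReflectiveM G) : ∃ v, Frame G v := by
  obtain ⟨r, s, t, h1, h2, h3, hD⟩ := exists_three hpos hr
  obtain ⟨u, v, hu, hv, huv⟩ := exists_pair hG hpos h1 h2 h3 hD
  have hvu : Bf G v u = 0 := by rw [Bf_comm hG, huv]
  have hU := hpos u hu.1
  have hV := hpos v hv.1
  set a := G *ᵥ u with ha
  set b := G *ᵥ v with hb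
  have Ba : ∀ y, Bf G y u = y 0 * a 0 + y 1 * a 1 + y 2 * a 2 := by
    intro y; simp [Bf, dotProduct, Fin.sum_univ_three, ha]
  have Bb : ∀ y, Bf G y v = y 0 * b 0 + y 1 * b 1 + y 2 * b 2 := by
    intro y; simp [Bf, dotProduct, Fin.sum_univ_three, hb]
  obtain ⟨w, r, g, hg, hC, hrw⟩ := exists_prim
    ![a 1 * b 2 - a 2 * b 1, a 2 * b 0 - a 0 * b 2, a 0 * b 1 - a 1 * b 0] (by
      intro h
      have e0 := congrFun h 0
      have e1 := congrFun h 1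
      have e2 := congrFun h 2
      simp at e0 e1 e2
      have : Bf G u u * Bf G v v = Bf G v u * Bf G u v := by
        rw [Ba, Ba, Bb, Bb]
        linear_combination (u 1 * v 2 - u 2 * v 1) * e0 + (u 2 * v 0 - u 0 * v 2) * e1
          + (u 0 * v 1 - u 1 * v 0) * e2
      rw [huv, mul_zero] at this
      exact (mul_pos hU hV).ne' this)
  have e0 := hC 0
  have e1 := hC 1
  have e2 := hC 2
  simp at e0 e1 e2
  have hw0 : w ≠ 0 := by rintro rfl; simp at hrw
  have hwu : Bf G w u = 0 := by
    rw [Ba]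
    apply mul_left_cancel₀ hg
    linear_combination -a 0 * e0 - a 1 * e1 - a 2 * e2
  have hwv : Bf G w v = 0 := by
    rw [Bb]
    apply mul_left_cancel₀ hg
    linear_combination -b 0 * e0 - b 1 * e1 - b 2 * e2
  have huw : Bf G u w = 0 := by rw [Bf_comm hG, hwu]
  have hvw : Bf G v w = 0 := by rw [Bf_comm hG, hwv]
  have hW := hpos w hw0
  have comp : ∀ y, Bf G y u = 0 → Bf G y v = 0 →
      y = (r 0 * y 0 + r 1 * y 1 + r 2 * y 2) • w := by
    intro y h1 h2
    rw [Ba] at h1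
    rw [Bb] at h2
    have c2 : y 0 * w 1 - y 1 * w 0 = 0 := by
      apply mul_left_cancel₀ hg
      linear_combination -y 0 * e1 + y 1 * e0 - b 2 * h1 + a 2 * h2
    have c1 : y 2 * w 0 - y 0 * w 2 = 0 := by
      apply mul_left_cancel₀ hg
      linear_combination -y 2 * e0 + y 0 * e2 - b 1 * h1 + a 1 * h2
    have c0 : y 1 * w 2 - y 2 * w 1 = 0 := by
      apply mul_left_cancel₀ hg
      linear_combination -y 1 * e2 + y 2 * e1 - b 0 * h1 + a 0 * h2
    ext i
    fin_cases i
    · simp; linear_combination (-y 0) * hrw + r 1 * c2 - r 2 * c1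
    · simp; linear_combination (-y 1) * hrw - r 0 * c2 + r 2 * c0
    · simp; linear_combination (-y 2) * hrw + r 0 * c1 - r 1 * c0
  have full : ∀ x, ∃ k : Fin 3 → ℤ, k 0 * Bf G u u = 2 * Bf G x u ∧ k 1 * Bf G v v = 2 * Bf G x v ∧
      k 2 * Bf G w w = 2 * Bf G x w ∧ (2 : ℤ) • x = k 0 • u + k 1 • v + k 2 • w := by
    intro x
    obtain ⟨m, hm⟩ := hu.2 x
    obtain ⟨n, hn⟩ := hv.2 x
    have hy := comp ((2 : ℤ) • x - m • u - n • v)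
      (by simp only [Bf_sub_left, Bf_smul_left]; rw [hvu]; linear_combination hm)
      (by simp only [Bf_sub_left, Bf_smul_left]; rw [huv]; linear_combination hn)
    obtain ⟨l, hl⟩ : ∃ l : ℤ, (2 : ℤ) • x - m • u - n • v = l • w := ⟨_, hy⟩
    refine ⟨![m, n, l], by simp; linear_combination -hm, by simp; linear_combination -hn, ?_, ?_⟩
    · have := congrArg (fun z => Bf G z w) hl
      simp only [Bf_sub_left, Bf_smul_left] at this
      rw [huw, hvw] at this
      simp; linear_combination -this
    · simp only [Matrix.cons_val]
      rw [← hl]; abel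
  refine ⟨![u, v, w], ?_, ?_, ?_⟩
  · intro i
    fin_cases i
    · exact hu
    · exact hv
    · refine ⟨hw0, fun x => ?_⟩
      obtain ⟨k, -, -, h, -⟩ := full x
      exact ⟨k 2, by simpa [mul_comm] using h.symm⟩
  · intro i j hij
    fin_cases i <;> fin_cases j <;>
      first
        | exact (hij rfl).elim
        | exact huv
        | exact hvu
        | exact huw
        | exact hwu
        | exact hvw
        | exact hwv
  · intro x
    obtain ⟨k, h0, h1, h2, h3⟩ := full x
    refine ⟨k, ?_, by simpa using h3⟩
    intro i; fin_cases i <;> simpa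

lemma Frame.det {G : Matrix (Fin 3) (Fin 3) ℤ} {v : Fin 3 → Fin 3 → ℤ}
    (h : Frame G v) : ∃ D E : ℤ, D * E = 8 ∧
      Bf G (v 0) (v 0) * Bf G (v 1) (v 1) * Bf G (v 2) (v 2) = D ^ 2 * G.det := by
  choose k hk1 hk2 using h.expand
  let W : Matrix (Fin 3) (Fin 3) ℤ := Matrix.of fun i j => k (Pi.single i 1) j
  refine ⟨(Matrix.of v).det, W.det, ?_, ?_⟩
  · rw [mul_comm, ← Matrix.det_mul]
    have : W * Matrix.of v = (2 : ℤ) • (1 : Matrix (Fin 3) (Fin 3) ℤ) := by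
      ext i j
      have := congrFun (hk2 (Pi.single i 1)) j
      simp only [Matrix.mul_apply, Fin.sum_univ_three, W, Matrix.of_apply]
      simp only [Pi.add_apply, Pi.smul_apply, smul_eq_mul] at this
      rw [← this, Matrix.smul_apply, Matrix.one_apply, Pi.single_apply]
      simp [eq_comm]
    rw [this, Matrix.det_smul]; simp
  · have : Matrix.of v * G * (Matrix.of v)ᵀ = Matrix.diagonal fun i => Bf G (v i) (v i) := by
      ext i j
      have e : (Matrix.of v * G * (Matrix.of v)ᵀ) i j = Bf G (v i) (v j) := by
        rw [Bf_expand]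
        simp [Matrix.mul_apply, Fin.sum_univ_three]; ring
      rw [e, Matrix.diagonal_apply]
      split_ifs with hij
      · rw [hij]
      · exact h.orth i j hij
    have := congrArg Matrix.det this
    rw [Matrix.det_mul, Matrix.det_mul, Matrix.det_transpose, Matrix.det_diagonal,
      Fin.prod_univ_three] at this
    rw [← this]; ring

/-! ### Neighbours -/

/-- The Gram matrix of the `p`-neighbour, for a form in normalized coordinates. -/
def NB (p g h : ℤ) (H : Matrix (Fin 3) (Fin 3) ℤ) : Matrix (Fin 3) (Fin 3) ℤ :=
  !![g, H 0 1, h; H 0 1, p ^ 2 * H 1 1, p * H 1 2; h, p * H 1 2, H 2 2]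

lemma symm_eq {H : Matrix (Fin 3) (Fin 3) ℤ} (hH : H.IsSymm) :
    H = !![H 0 0, H 0 1, H 0 2; H 0 1, H 1 1, H 1 2; H 0 2, H 1 2, H 2 2] := by
  have h1 := hH.apply 0 1
  have h2 := hH.apply 0 2
  have h3 := hH.apply 1 2
  ext i j; fin_cases i <;> fin_cases j <;> simp [h1, h2, h3]

lemma local_away {R : Type*} [CommRing R] (p pi g x h y z t : R) (hp : p * pi = 1) :
    (!![pi, 0, 0; 0, p, 0; 0, 0, 1])ᵀ * !![p ^ 2 * g, x, p * h; x, y, z; p * h, z, t] *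
      !![pi, 0, 0; 0, p, 0; 0, 0, 1] = !![g, x, h; x, p ^ 2 * y, p * z; h, p * z, t] := by
  ext i j
  fin_cases i <;> fin_cases j <;>
    simp [Matrix.mul_apply, Fin.sum_univ_three]
  · linear_combination g * (p * pi + 1) * hp
  · linear_combination x * hp
  · linear_combination h * hp
  · linear_combination x * hp
  · ring
  · linear_combination h * hp
  · ring

lemma local_at {R : Type*} [CommRing R] (p g x h y z t m : R)
    (hm : m * (2 * x + p * (g + y)) = 1) :
    ∃ S : Matrix (Fin 3) (Fin 3) R, IsUnit S.det ∧
      Sᵀ * !![p ^ 2 * g, x, p * h; x, y, z; p * h, z, t] * S =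
        !![g, x, h; x, p ^ 2 * y, p * z; h, p * z, t] := by
  refine ⟨!![-((g - y) * m), -(2 * (x + p * y) * m), -(2 * (h + z) * m);
    -1 - p * ((g - y) * m), p - p * (2 * (x + p * y) * m), -(p * (2 * (h + z) * m));
    0, 0, 1], ?_, ?_⟩
  · have : (!![-((g - y) * m), -(2 * (x + p * y) * m), -(2 * (h + z) * m);
      -1 - p * ((g - y) * m), p - p * (2 * (x + p * y) * m), -(p * (2 * (h + z) * m));
      0, 0, 1]).det = -1 := by
      rw [Matrix.det_fin_three]
      simp
      linear_combination -hm
    rw [this]; exact isUnit_one.neg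
  · ext i j
    fin_cases i <;> fin_cases j <;>
      simp [Matrix.mul_apply, Fin.sum_univ_three] <;> grind

lemma sameGenus_of_basis {G : Matrix (Fin 3) (Fin 3) ℤ} (hG : G.IsSymm) (p : ℕ) (hp : p.Prime)
    (hp2 : p ≠ 2)
    (U : Matrix (Fin 3) (Fin 3) ℤ) (hU : IsUnit U.det) (g h : ℤ)
    (h00 : (Uᵀ * G * U) 0 0 = p ^ 2 * g) (h02 : (Uᵀ * G * U) 0 2 = p * h)
    (h01 : ¬ (p : ℤ) ∣ (Uᵀ * G * U) 0 1) :
    SameGenusM G (NB p g h (Uᵀ * G * U)) := by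
  have hH : (Uᵀ * G * U).IsSymm := by
    unfold Matrix.IsSymm
    rw [Matrix.transpose_mul, Matrix.transpose_mul, Matrix.transpose_transpose, hG.eq,
      Matrix.mul_assoc]
  set H := Uᵀ * G * U with hHdef
  intro l hl
  have hlp : l.Prime := Fact.out
  let c : ℤ →+* ℤ_[l] := Int.castRingHom _
  have key : ∃ S : Matrix (Fin 3) (Fin 3) ℤ_[l], IsUnit S.det ∧
      Sᵀ * H.map (Int.cast : ℤ → ℤ_[l]) * S = (NB p g h H).map (Int.cast : ℤ → ℤ_[l]) := by
    have e1 : H.map (Int.cast : ℤ → ℤ_[l]) =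
        !![(p : ℤ_[l]) ^ 2 * g, H 0 1, p * h; H 0 1, H 1 1, H 1 2; p * h, H 1 2, H 2 2] := by
      rw [symm_eq hH, h00, h02]
      ext i j; fin_cases i <;> fin_cases j <;> simp
    have e2 : (NB p g h H).map (Int.cast : ℤ → ℤ_[l]) =
        !![(g : ℤ_[l]), H 0 1, h; H 0 1, (p : ℤ_[l]) ^ 2 * H 1 1, p * H 1 2;
          h, p * H 1 2, H 2 2] := by
      unfold NB
      ext i j; fin_cases i <;> fin_cases j <;> simp
    rw [e1, e2]
    by_cases hlp' : l = p
    · subst hlp'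
      have hu : IsUnit ((2 * H 0 1 + l * (g + H 1 1) : ℤ) : ℤ_[l]) := by
        rw [PadicInt.isUnit_iff, PadicInt.norm_intCast_eq_one_iff, Int.isCoprime_iff_gcd_eq_one]
        rw [← Int.isCoprime_iff_gcd_eq_one, isCoprime_comm,
          Prime.coprime_iff_not_dvd (Nat.prime_iff_prime_int.1 hlp)]
        intro hd
        have h3 : (l : ℤ) ∣ 2 * H 0 1 := (Int.dvd_add_left (Dvd.intro _ rfl)).1 hd
        rcases (Nat.prime_iff_prime_int.1 hlp).dvd_or_dvd h3 with h4 | h4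
        · have : l ∣ 2 := by exact_mod_cast h4
          exact hp2 ((Nat.prime_dvd_prime_iff_eq hlp Nat.prime_two).1 this)
        · exact h01 h4
      obtain ⟨m, hm⟩ := hu.exists_left_inv
      exact local_at _ _ _ _ _ _ _ m (by rw [← hm]; push_cast; ring)
    · have hu : IsUnit ((p : ℤ) : ℤ_[l]) := by
        rw [PadicInt.isUnit_iff, PadicInt.norm_intCast_eq_one_iff]
        exact Nat.isCoprime_iff_coprime.2 ((Nat.coprime_primes hp hlp).2 (Ne.symm hlp'))
      obtain ⟨m, hm⟩ := hu.exists_right_inv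
      refine ⟨!![m, 0, 0; 0, (p : ℤ_[l]), 0; 0, 0, 1], ?_,
        local_away _ m _ _ _ _ _ _ (by simpa using hm)⟩
      rw [Matrix.det_fin_three]
      simp
      simp at hm
      exact ⟨isUnit_iff_exists_inv'.2 ⟨_, hm⟩, isUnit_iff_exists_inv.2 ⟨_, hm⟩⟩
  obtain ⟨S, hS, hS2⟩ := key
  refine ⟨c.mapMatrix U * S, ?_, ?_⟩
  · rw [Matrix.det_mul, ← RingHom.map_det]
    exact (hU.map c).mul hS
  · have e : H.map (Int.cast : ℤ → ℤ_[l]) =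
        (c.mapMatrix U)ᵀ * c.mapMatrix G * c.mapMatrix U := by
      have : H.map (Int.cast : ℤ → ℤ_[l]) = c.mapMatrix H := rfl
      rw [this, hHdef, map_mul, map_mul]
      rfl
    rw [← hS2, e]
    have : G.map (Int.cast : ℤ → ℤ_[l]) = c.mapMatrix G := rfl
    rw [this, Matrix.transpose_mul]
    simp only [Matrix.mul_assoc]

lemma solve_mod (p : ℕ) (hp : p.Prime) (a b : ℤ) (ha : ¬ (p : ℤ) ∣ a) :
    ∃ k : ℤ, (p : ℤ) ∣ b + k * a := by
  obtain ⟨x, y, h⟩ := (Prime.coprime_iff_not_dvd (Nat.prime_iff_prime_int.1 hp)).2 ha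
  exact ⟨-b * y, b * x, by linear_combination (-b) * h⟩

lemma exists_U0 (p : ℕ) (hp : p.Prime) (w : Fin 3 → ℤ) (hw : ∃ i, ¬ (p : ℤ) ∣ w i) :
    ∃ (U : Matrix (Fin 3) (Fin 3) ℤ) (m : ℤ), IsUnit U.det ∧ ¬ (p : ℤ) ∣ m ∧
      ∀ i, (p : ℤ) ∣ U i 0 - m * w i := by
  obtain ⟨i, hi⟩ := hw
  obtain ⟨k, hk⟩ := solve_mod p hp (w i) (-1) hi
  have hk0 : ¬ (p : ℤ) ∣ k := by
    intro h
    have h1 : (p : ℤ) ∣ 1 := by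
      have := dvd_sub (h.mul_right (w i)) hk
      simpa using this
    exact (Nat.prime_iff_prime_int.1 hp).not_isUnit (isUnit_of_dvd_one h1)
  have hk' : (p : ℤ) ∣ 1 - k * w i := by
    obtain ⟨c, hc⟩ := hk
    exact ⟨-c, by linear_combination -hc⟩
  fin_cases i
  · refine ⟨!![1, 0, 0; k * w 1, 1, 0; k * w 2, 0, 1], k, ?_, hk0, ?_⟩
    · rw [Matrix.det_fin_three]; simp
    · intro i; fin_cases i
      · simpa using hk'
      · simp
      · simp
  · refine ⟨!![k * w 0, 1, 0; 1, 0, 0; k * w 2, 0, 1], k, ?_, hk0, ?_⟩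
    · rw [Matrix.det_fin_three]; simp
    · intro i; fin_cases i
      · simp
      · simpa using hk'
      · simp
  · refine ⟨!![k * w 0, 1, 0; k * w 1, 0, 1; 1, 0, 0], k, ?_, hk0, ?_⟩
    · rw [Matrix.det_fin_three]; simp
    · intro i; fin_cases i
      · simp
      · simp
      · simpa using hk'

lemma exists_U2 (p : ℕ) (hp : p.Prime) (hp2 : p ≠ 2) (H : Matrix (Fin 3) (Fin 3) ℤ)
    (hH : H.IsSymm) (hdet : ¬ (p : ℤ) ∣ H.det) (h00 : (p : ℤ) ∣ H 0 0) :
    ∃ (U : Matrix (Fin 3) (Fin 3) ℤ) (g h : ℤ), IsUnit U.det ∧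
      (Uᵀ * H * U) 0 0 = p ^ 2 * g ∧ (Uᵀ * H * U) 0 2 = p * h ∧
      ¬ (p : ℤ) ∣ (Uᵀ * H * U) 0 1 ∧ U 0 0 = 1 ∧ (p : ℤ) ∣ U 1 0 ∧ (p : ℤ) ∣ U 2 0 := by
  have pp := Nat.prime_iff_prime_int.1 hp
  have h2 : ¬ (p : ℤ) ∣ 2 := by
    intro h4
    have : p ∣ 2 := by exact_mod_cast h4
    exact hp2 ((Nat.prime_dvd_prime_iff_eq hp Nat.prime_two).1 this)
  obtain ⟨m, hm⟩ := h00
  have s1 := hH.apply 0 1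
  have s2 := hH.apply 0 2
  have s3 := hH.apply 1 2
  by_cases h1 : (p : ℤ) ∣ H 0 1
  · have h3 : ¬ (p : ℤ) ∣ H 0 2 := by
      intro h3
      apply hdet
      obtain ⟨a, ha⟩ := h1
      obtain ⟨b, hb⟩ := h3
      rw [Matrix.det_fin_three, s1, s2, s3, hm, ha, hb]
      exact ⟨m * H 1 1 * H 2 2 - m * H 1 2 ^ 2 - p * a * a * H 2 2 + 2 * p * a * b * H 1 2
        - p * b * b * H 1 1, by ring⟩
    obtain ⟨k, e, hk⟩ := solve_mod p hp (2 * H 0 2) m (fun h => (pp.dvd_or_dvd h).elim h2 h3)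
    obtain ⟨t, f, ht⟩ := solve_mod p hp (H 0 2) (H 0 1) h3
    refine ⟨!![1, 0, 0; 0, 0, 1; p * k, 1, t], e + k ^ 2 * H 2 2,
      f + k * H 1 2 + k * t * H 2 2, ?_, ?_, ?_, ?_, ?_, ?_, ?_⟩
    · rw [Matrix.det_fin_three]; simp
    · simp [Matrix.mul_apply, Fin.sum_univ_three, s1, s2, s3, hm]
      linear_combination (p : ℤ) * hk
    · simp [Matrix.mul_apply, Fin.sum_univ_three, s1, s2, s3, hm]
      linear_combination ht
    · intro hd
      apply h3
      have : (!![1, 0, 0; 0, 0, 1; p * k, 1, t]ᵀ * H * !![1, 0, 0; 0, 0, 1; p * k, 1, t]) 0 1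
        = H 0 2 + p * (k * H 2 2) := by
        simp [Matrix.mul_apply, Fin.sum_univ_three]
        ring
      rw [this] at hd
      exact (Int.dvd_add_left (Dvd.intro _ rfl)).1 hd
    · simp
    · simp
    · simp
  · obtain ⟨k, e, hk⟩ := solve_mod p hp (2 * H 0 1) m (fun h => (pp.dvd_or_dvd h).elim h2 h1)
    obtain ⟨t, f, ht⟩ := solve_mod p hp (H 0 1) (H 0 2) h1
    refine ⟨!![1, 0, 0; p * k, 1, t; 0, 0, 1], e + k ^ 2 * H 1 1,
      f + k * H 1 2 + k * t * H 1 1, ?_, ?_, ?_, ?_, ?_, ?_, ?_⟩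
    · rw [Matrix.det_fin_three]; simp
    · simp [Matrix.mul_apply, Fin.sum_univ_three, s1, s2, s3, hm]
      linear_combination (p : ℤ) * hk
    · simp [Matrix.mul_apply, Fin.sum_univ_three, s1, s2, s3, hm]
      linear_combination ht
    · intro hd
      apply h1
      have : (!![1, 0, 0; p * k, 1, t; 0, 0, 1]ᵀ * H * !![1, 0, 0; p * k, 1, t; 0, 0, 1]) 0 1
        = H 0 1 + p * (k * H 1 1) := by
        simp [Matrix.mul_apply, Fin.sum_univ_three]
        ring
      rw [this] at hd
      exact (Int.dvd_add_left (Dvd.intro _ rfl)).1 hd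
    · simp
    · simp
    · simp

lemma exists_basis {G : Matrix (Fin 3) (Fin 3) ℤ} (hG : G.IsSymm) (p : ℕ) (hp : p.Prime)
    (hp2 : p ≠ 2) (hdet : ¬ (p : ℤ) ∣ G.det) (w : Fin 3 → ℤ) (hw : ∃ i, ¬ (p : ℤ) ∣ w i)
    (hww : (p : ℤ) ∣ Bf G w w) :
    ∃ (U : Matrix (Fin 3) (Fin 3) ℤ) (g h m : ℤ), IsUnit U.det ∧
      (Uᵀ * G * U) 0 0 = p ^ 2 * g ∧ (Uᵀ * G * U) 0 2 = p * h ∧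
      ¬ (p : ℤ) ∣ (Uᵀ * G * U) 0 1 ∧ ¬ (p : ℤ) ∣ m ∧ ∀ i, (p : ℤ) ∣ U i 0 - m * w i := by
  obtain ⟨U, m, hU, hm, hUw⟩ := exists_U0 p hp w hw
  have hH : (Uᵀ * G * U).IsSymm := by
    unfold Matrix.IsSymm
    rw [Matrix.transpose_mul, Matrix.transpose_mul, Matrix.transpose_transpose, hG.eq,
      Matrix.mul_assoc]
  choose y hy using hUw
  have h00 : (p : ℤ) ∣ (Uᵀ * G * U) 0 0 := by
    have e : (Uᵀ * G * U) 0 0 = Bf G (m • w + (p : ℤ) • y) (m • w + (p : ℤ) • y) := by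
      have e1 : m • w + (p : ℤ) • y = fun i => U i 0 := by
        ext i
        simp only [Pi.add_apply, Pi.smul_apply, smul_eq_mul]
        linear_combination -hy i
      rw [e1, Bf_expand]
      simp [Matrix.mul_apply, Fin.sum_univ_three]; ring
    rw [e]
    simp only [Bf_add_left, Bf_add_right, Bf_smul_left, Bf_smul_right]
    obtain ⟨c, hc⟩ := hww
    rw [hc]
    exact ⟨m * m * c + m * Bf G w y + m * Bf G y w + p * Bf G y y, by ring⟩
  have hdet' : ¬ (p : ℤ) ∣ (Uᵀ * G * U).det := by
    rw [Matrix.det_mul, Matrix.det_mul, Matrix.det_transpose]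
    intro h
    rw [hU.dvd_mul_right, mul_comm, hU.dvd_mul_right] at h
    exact hdet h
  obtain ⟨V, g, h, hV, k1, k2, k3, v0, ⟨a, v1⟩, ⟨b, v2⟩⟩ := exists_U2 p hp hp2 _ hH hdet' h00
  have e : (U * V)ᵀ * G * (U * V) = Vᵀ * (Uᵀ * G * U) * V := by
    rw [Matrix.transpose_mul]; simp only [Matrix.mul_assoc]
  refine ⟨U * V, g, h, m, ?_, ?_, ?_, ?_, hm, ?_⟩
  · rw [Matrix.det_mul]; exact hU.mul hV
  · rw [e, k1]
  · rw [e, k2]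
  · rw [e]; exact k3
  · intro i
    refine ⟨y i + U i 1 * a + U i 2 * b, ?_⟩
    simp only [Matrix.mul_apply, Fin.sum_univ_three]
    rw [v0, v1, v2]
    linear_combination hy i

/-- The key estimate. -/
lemma key_bound {G : Matrix (Fin 3) (Fin 3) ℤ} (hG : G.IsSymm) (hpos : PosDefM G)
    (htr : TotallyReflectiveM G) (hsq : Squarefree G.det)
    (p : ℕ) (hp : p.Prime) (hp7 : 7 ≤ p) (hpd : ¬ (p : ℤ) ∣ G.det) :
    ∃ T : ℤ, 0 < T ∧ 27 * T ≤ (4 * p ^ 2) ^ 3 ∧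
      ∀ q : ℕ, q.Prime → (q : ℤ) ∣ G.det → (q : ℤ) ∣ 2 * T := by
  have pp := Nat.prime_iff_prime_int.1 hp
  have hF : Fact p.Prime := ⟨hp⟩
  have hrefl : ReflectiveM G := htr G hG hpos (fun l _ => ⟨1, by simp, by simp⟩)
  obtain ⟨v, hv⟩ := exists_frame hG hpos hrefl
  obtain ⟨D, E, hDE, hdet⟩ := hv.det
  have hp2 : p ≠ 2 := by omega
  -- odd primes do not divide `D`
  have hodd : ∀ q : ℕ, q.Prime → q ≠ 2 → ¬ (q : ℤ) ∣ D := by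
    intro q hq hq2 h
    have h1 : (q : ℤ) ∣ 2 ^ 3 := by
      have := h.mul_right E
      rw [hDE] at this; exact this
    have h2 : (q : ℤ) ∣ 2 := (Nat.prime_iff_prime_int.1 hq).dvd_of_dvd_pow h1
    have : q ∣ 2 := by exact_mod_cast h2
    exact hq2 ((Nat.prime_dvd_prime_iff_eq hq Nat.prime_two).1 this)
  have hap : ¬ (p : ℤ) ∣ Bf G (v 0) (v 0) * Bf G (v 1) (v 1) * Bf G (v 2) (v 2) := by
    rw [hdet]
    intro h
    rcases pp.dvd_or_dvd h with h | h
    · exact hodd p hp hp2 (pp.dvd_of_dvd_pow h)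
    · exact hpd h
  have hai : ∀ i, ¬ (p : ℤ) ∣ Bf G (v i) (v i) := by
    intro i h
    apply hap
    fin_cases i
    · exact (h.mul_right _).mul_right _
    · exact (h.mul_left _).mul_right _
    · exact h.mul_left _
  have hposi : ∀ i, 0 < Bf G (v i) (v i) := fun i => hpos _ (hv.pr i).1
  -- isotropic vector
  have nz : ∀ i, ((Bf G (v i) (v i) : ℤ) : ZMod p) ≠ 0 := fun i h =>
    hai i ((ZMod.intCast_zmod_eq_zero_iff_dvd _ _).1 h)
  obtain ⟨x, y, z, hx, hy, hz, hxyz⟩ := conic p hp7 _ _ _ (nz 0) (nz 1) (nz 2)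
  obtain ⟨x, rfl⟩ := ZMod.intCast_surjective x
  obtain ⟨y, rfl⟩ := ZMod.intCast_surjective y
  obtain ⟨z, rfl⟩ := ZMod.intCast_surjective z
  have hxp : ¬ (p : ℤ) ∣ x := fun h => hx ((ZMod.intCast_zmod_eq_zero_iff_dvd _ _).2 h)
  have hyp : ¬ (p : ℤ) ∣ y := fun h => hy ((ZMod.intCast_zmod_eq_zero_iff_dvd _ _).2 h)
  have hzp : ¬ (p : ℤ) ∣ z := fun h => hz ((ZMod.intCast_zmod_eq_zero_iff_dvd _ _).2 h)
  have hiso : (p : ℤ) ∣ Bf G (v 0) (v 0) * x ^ 2 + Bf G (v 1) (v 1) * y ^ 2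
      + Bf G (v 2) (v 2) * z ^ 2 := by
    rw [← ZMod.intCast_zmod_eq_zero_iff_dvd]
    push_cast; exact hxyz
  set w : Fin 3 → ℤ := x • v 0 + y • v 1 + z • v 2 with hw
  have o01 := hv.orth 0 1 (by decide)
  have o02 := hv.orth 0 2 (by decide)
  have o12 := hv.orth 1 2 (by decide)
  have o10 := hv.orth 1 0 (by decide)
  have o20 := hv.orth 2 0 (by decide)
  have o21 := hv.orth 2 1 (by decide)
  have bw : ∀ i, ¬ (p : ℤ) ∣ Bf G w (v i) := by
    intro i h
    fin_cases i
    · simp only [hw, Bf_add_left, Bf_smul_left, Fin.zero_eta, o10, o20] at h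
      simp only [mul_zero, add_zero] at h
      exact (pp.dvd_or_dvd h).elim hxp (hai 0)
    · simp only [hw, Bf_add_left, Bf_smul_left, Fin.mk_one, o01, o21] at h
      simp only [mul_zero, add_zero, zero_add] at h
      exact (pp.dvd_or_dvd h).elim hyp (hai 1)
    · simp only [hw, Bf_add_left, Bf_smul_left, Fin.reduceFinMk, o02, o12] at h
      simp only [mul_zero, zero_add] at h
      exact (pp.dvd_or_dvd h).elim hzp (hai 2)
  have hww : (p : ℤ) ∣ Bf G w w := by
    convert hiso using 1
    simp only [hw, Bf_add_left, Bf_smul_left, Bf_add_right, Bf_smul_right, o01, o02, o12, o10,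
      o20, o21]
    ring
  have hwi : ∃ i, ¬ (p : ℤ) ∣ w i := by
    by_contra hc
    push Not at hc
    apply bw 0
    rw [Bf_expand]
    exact dvd_add (dvd_add ((hc 0).mul_right _) ((hc 1).mul_right _)) ((hc 2).mul_right _)
  obtain ⟨U, g, h, m, hU, k00, k02, k01, hm, hUw⟩ := exists_basis hG p hp hp2 hpd w hwi hww
  have hsg := sameGenus_of_basis hG p hp hp2 U hU g h k00 k02 k01
  have hH : (Uᵀ * G * U).IsSymm := by
    unfold Matrix.IsSymm
    rw [Matrix.transpose_mul, Matrix.transpose_mul, Matrix.transpose_transpose, hG.eq,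
      Matrix.mul_assoc]
  have hBH := fun a b => Bf_mulVec (G := G) U a b
  set H := Uᵀ * G * U with hHdef
  set G' := NB p g h H with hG'
  have hG's : G'.IsSymm := by
    unfold Matrix.IsSymm
    rw [hG', NB]
    ext i j; fin_cases i <;> fin_cases j <;> simp
  have s1 := hH.apply 0 1
  have s2 := hH.apply 0 2
  have s3 := hH.apply 1 2
  have hp0 : (p : ℤ) ≠ 0 := by exact_mod_cast hp.ne_zero
  -- comparison of the forms
  have cmp : ∀ a b : Fin 3 → ℤ, Bf H ![a 0, a 1, a 2] ![b 0, p ^ 2 * b 1, p * b 2]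
      = Bf G' ![p ^ 2 * a 0, a 1, p * a 2] b := by
    intro a b
    rw [Bf_expand, Bf_expand, s1, s2, s3, k00, k02, hG']
    simp [NB]; ring
  have cmp2 : ∀ b : Fin 3 → ℤ, Bf H ![b 0, p ^ 2 * b 1, p * b 2] ![b 0, p ^ 2 * b 1, p * b 2]
      = p ^ 2 * Bf G' b b := by
    intro b
    rw [Bf_expand, Bf_expand, s1, s2, s3, k00, k02, hG']
    simp [NB]; ring
  obtain ⟨W, hUW⟩ : ∃ W : Matrix (Fin 3) (Fin 3) ℤ, U * W = 1 :=
    ⟨U⁻¹, Matrix.mul_nonsing_inv U hU⟩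
  have hWU : W * U = 1 := mul_eq_one_comm.1 hUW
  have hG'p : PosDefM G' := by
    intro b hb
    have hne : U *ᵥ ![b 0, p ^ 2 * b 1, p * b 2] ≠ 0 := by
      intro h0
      have h1 : W *ᵥ (U *ᵥ ![b 0, p ^ 2 * b 1, p * b 2]) = 0 := by rw [h0, Matrix.mulVec_zero]
      rw [Matrix.mulVec_mulVec, hWU, Matrix.one_mulVec] at h1
      apply hb
      have e0 := congrFun h1 0
      have e1 := congrFun h1 1
      have e2 := congrFun h1 2
      simp [hp.ne_zero] at e0 e1 e2
      ext i; fin_cases i <;> simp [e0, e1, e2]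
    have h1 := hpos _ hne
    rw [hBH, cmp2] at h1
    exact pos_of_mul_pos_right h1 (by positivity)
  obtain ⟨v', hv'⟩ := exists_frame hG's hG'p (htr G' hG's hG'p hsg)
  -- a root outside `L`
  obtain ⟨j, hj⟩ : ∃ j, ¬ (p : ℤ) ∣ v' j 0 := by
    by_contra hc
    push Not at hc
    obtain ⟨k, -, hk⟩ := hv'.expand (Pi.single 0 1)
    have := congrFun hk 0
    simp at this
    have h2 : (p : ℤ) ∣ 2 := by
      rw [this]
      exact dvd_add (dvd_add ((hc 0).mul_left _) ((hc 1).mul_left _)) ((hc 2).mul_left _)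
    have h3 := Int.le_of_dvd (by norm_num) h2
    omega
  set b := v' j with hb
  set u : Fin 3 → ℤ := U *ᵥ ![b 0, p ^ 2 * b 1, p * b 2] with hu
  have hb' := hG'p b (hv'.pr j).1
  have huu : Bf G u u = p ^ 2 * Bf G' b b := by rw [hu, hBH, cmp2]
  have hdv : ∀ a, Bf G' b b ∣ 2 * Bf G a u := by
    intro a
    have e : a = U *ᵥ (W *ᵥ a) := by rw [Matrix.mulVec_mulVec, hUW, Matrix.one_mulVec]
    rw [e, hu, hBH]
    have e3 : W *ᵥ a = ![(W *ᵥ a) 0, (W *ᵥ a) 1, (W *ᵥ a) 2] := by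
      ext i; fin_cases i <;> rfl
    rw [e3, cmp]
    exact (hv'.pr j).2 _
  have hunz : ∀ i, ¬ (p : ℤ) ∣ Bf G u (v i) := by
    intro i hd
    choose r hr using hUw
    have e : u = (b 0 * m) • w + (p : ℤ) • (fun i => b 0 * r i + p * U i 1 * b 1 + U i 2 * b 2) := by
      ext i
      simp [hu, Matrix.mulVec, dotProduct, Fin.sum_univ_three]
      linear_combination b 0 * hr i
    rw [e, Bf_add_left, Bf_smul_left, Bf_smul_left] at hd
    have := (Int.dvd_add_left (Dvd.intro _ rfl)).1 hd
    rcases pp.dvd_or_dvd this with h1 | h1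
    · exact (pp.dvd_or_dvd h1).elim hj hm
    · exact bw i h1
  obtain ⟨k, hk1, hk2⟩ := hv.expand u
  have hy : ∀ i, ∃ y, k i * Bf G (v i) (v i) = Bf G' b b * y := by
    intro i
    rw [hk1, Bf_comm hG]
    exact hdv (v i)
  choose t ht using hy
  have hknz : ∀ i, k i ≠ 0 := by
    intro i h0
    have := hk1 i
    rw [h0, zero_mul] at this
    have h3 : Bf G u (v i) = 0 := by omega
    exact hunz i (by rw [h3]; exact dvd_zero _)
  have htpos : ∀ i, 0 < k i * t i := by
    intro i
    have h1 : 0 < Bf G' b b * (k i * t i) := by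
      have : Bf G' b b * (k i * t i) = k i ^ 2 * Bf G (v i) (v i) := by
        linear_combination (-k i) * ht i
      rw [this]
      have := hposi i
      have := hknz i
      positivity
    exact pos_of_mul_pos_right h1 hb'.le
  have hsum : k 0 * t 0 + k 1 * t 1 + k 2 * t 2 = 4 * p ^ 2 := by
    apply mul_left_cancel₀ hb'.ne'
    have h1 : Bf G ((2 : ℤ) • u) ((2 : ℤ) • u) = k 0 ^ 2 * Bf G (v 0) (v 0)
        + k 1 ^ 2 * Bf G (v 1) (v 1) + k 2 ^ 2 * Bf G (v 2) (v 2) := by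
      rw [hk2]
      simp only [Bf_add_left, Bf_smul_left, Bf_add_right, Bf_smul_right, o01, o02, o12, o10,
        o20, o21]
      ring
    rw [Bf_smul_left, Bf_smul_right, huu] at h1
    linear_combination -h1 - k 0 * ht 0 - k 1 * ht 1 - k 2 * ht 2
  refine ⟨(k 0 * t 0) * (k 1 * t 1) * (k 2 * t 2),
    mul_pos (mul_pos (htpos 0) (htpos 1)) (htpos 2), ?_, ?_⟩
  · rw [← hsum]
    have h0 := htpos 0
    have h1 := htpos 1
    have h2 := htpos 2
    generalize k 0 * t 0 = X at *
    generalize k 1 * t 1 = Y at *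
    generalize k 2 * t 2 = Z at *
    nlinarith [mul_nonneg h0.le (sq_nonneg (Y - Z)), mul_nonneg h1.le (sq_nonneg (X - Z)),
      mul_nonneg h2.le (sq_nonneg (X - Y)), mul_nonneg h0.le (sq_nonneg (X - Z)),
      mul_nonneg h0.le (sq_nonneg (X - Y)), mul_nonneg h1.le (sq_nonneg (X - Y)),
      mul_nonneg h1.le (sq_nonneg (Y - Z)), mul_nonneg h2.le (sq_nonneg (X - Z)),
      mul_nonneg h2.le (sq_nonneg (Y - Z))]
  · intro q hq hqd
    have qp := Nat.prime_iff_prime_int.1 hq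
    by_cases hq2 : q = 2
    · subst hq2; exact Dvd.intro _ rfl
    apply Dvd.dvd.mul_left
    -- `q` divides one of the norms but not all
    have hex : ∃ i, (q : ℤ) ∣ Bf G (v i) (v i) := by
      have h1 : (q : ℤ) ∣ Bf G (v 0) (v 0) * Bf G (v 1) (v 1) * Bf G (v 2) (v 2) := by
        rw [hdet]; exact hqd.mul_left _
      rcases qp.dvd_or_dvd h1 with h1 | h1
      · rcases qp.dvd_or_dvd h1 with h1 | h1
        · exact ⟨0, h1⟩
        · exact ⟨1, h1⟩
      · exact ⟨2, h1⟩
    have hnex : ∃ i, ¬ (q : ℤ) ∣ Bf G (v i) (v i) := by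
      by_contra hc
      push Not at hc
      have h1 : (q : ℤ) * q ∣ D ^ 2 * G.det := by
        rw [← hdet]
        exact (mul_dvd_mul (hc 0) (hc 1)).mul_right _
      have h2 : IsCoprime ((q : ℤ) * q) (D ^ 2) := by
        have : IsCoprime (q : ℤ) D := (Prime.coprime_iff_not_dvd qp).2 (hodd q hq hq2)
        exact (this.mul_left this).pow_right
      exact qp.not_isUnit (hsq _ (h2.dvd_of_dvd_mul_left h1))
    have hT : ∃ i, (q : ℤ) ∣ k i * t i := by
      by_cases hqb : (q : ℤ) ∣ Bf G' b b
      · obtain ⟨i, hi⟩ := hnex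
        have h1 : (q : ℤ) ∣ k i * Bf G (v i) (v i) := by rw [ht]; exact hqb.mul_right _
        exact ⟨i, ((qp.dvd_or_dvd h1).resolve_right hi).mul_right _⟩
      · obtain ⟨i, hi⟩ := hex
        have h1 : (q : ℤ) ∣ Bf G' b b * t i := by rw [← ht]; exact hi.mul_left _
        exact ⟨i, ((qp.dvd_or_dvd h1).resolve_left hqb).mul_left _⟩
    obtain ⟨i, hi⟩ := hT
    fin_cases i
    · exact (hi.mul_right _).mul_right _
    · exact (hi.mul_left _).mul_right _
    · exact hi.mul_left _

/-- Theorem 3.8(a): a strongly square free, totally-reflective, positive definite ternary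
lattice has a determinant with at most 10 (pairwise distinct) prime factors. -/
theorem ssf_totally_reflective_dim3_num_primes_le_ten
    (G : Matrix (Fin 3) (Fin 3) ℤ) (hsymm : G.IsSymm) (hpos : PosDefM G)
    (hssf : StronglySquareFreeM G) (htr : TotallyReflectiveM G)
    (s : ℕ) (q : Fin s → ℕ) (hq : ∀ i, (q i).Prime) (hinj : Function.Injective q)
    (hdet : G.det = ∏ i, (q i : ℤ)) : s ≤ 10 := by
  by_contra hs
  push Not at hs
  classical
  set S : Finset ℕ := Finset.univ.image q with hS
  have hSc : S.card = s := by
    rw [hS, Finset.card_image_of_injective _ hinj]; simp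
  have hSp : ∀ p ∈ S, p.Prime := by
    intro p hp
    obtain ⟨i, -, rfl⟩ := Finset.mem_image.1 hp
    exact hq i
  have hprod : ∏ p ∈ S, p = ∏ i, q i := by
    rw [hS, Finset.prod_image (fun a _ b _ h => hinj h)]
  have hge := nt_prod_ge S hSp (by omega)
  set d : ℕ := ∏ p ∈ S, p with hd
  have hdet' : G.det = (d : ℤ) := by
    rw [hdet, hprod]; push_cast; rfl
  obtain ⟨p, hp, hp7, hpd, hlt⟩ := nt_main d hge
  have hsq : Squarefree G.det := by
    rw [hdet', Int.squarefree_natCast, hd]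
    apply Finset.squarefree_prod_of_pairwise_isCoprime
    rotate_left
    · intro i hi; exact (hSp i hi).squarefree
    · intro a ha b hb hab
      exact Nat.coprime_iff_isRelPrime.1 ((Nat.coprime_primes (hSp a ha) (hSp b hb)).2 hab)
  obtain ⟨T, hT0, hT, hTq⟩ := key_bound hsymm hpos htr hsq p hp hp7
    (by rw [hdet']; exact_mod_cast hpd)
  have hdvd : d ∣ (2 * T).natAbs := by
    rw [hd]
    apply Finset.prod_primes_dvd
    · intro a ha; exact (hSp a ha).prime
    · intro a ha
      rw [← Int.natCast_dvd]
      apply hTq a (hSp a ha)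
      rw [hdet', hd]
      exact_mod_cast Finset.dvd_prod_of_mem (fun x => x) ha
  have hle : (d : ℤ) ≤ 2 * T := Int.le_of_dvd (by omega) (Int.natCast_dvd.2 hdvd)
  have hlt' : 5 * (p : ℤ) ^ 6 < d := by exact_mod_cast hlt
  have h1 : (4 * (p : ℤ) ^ 2) ^ 3 = 64 * (p : ℤ) ^ 6 := by ring
  have h2 : 0 < (p : ℤ) ^ 6 := by
    have : 0 < (p : ℤ) := by exact_mod_cast hp.pos
    positivity
  linarith
end
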